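/- arXiv:2402.13477 — 8 statements merged into one kernel-verified Lean document; each statement's English description precedes it below -/
import Mathlib

section
/- Let K be a field, 2 ≤ t ≤ n, S = K[x_1,…,x_n], and I = I_t(L_n) the t-path ideal of the line graph. Then I is normally torsion-free: for every s ≥ 1, the set of associated primes of the S-module S/I^s equals the set of associated primes of S/I. -/
open MvPolynomial

/-- Generator of the path ideal: the product `x_{i+1} ⋯ x_{i+t}` of the variables with
0-based indices in `[i, i+t)`. -/
noncomputable def pathGen (K : Type*) [Field K] (n t i : ℕ) : MvPolynomial (Fin n) K :=
  ∏ j ∈ Finset.univ.filter (fun j : Fin n => i ≤ (j : ℕ) ∧ (j : ℕ) < i + t), X j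

/-- The `t`-path ideal `I_t(L_n)` of the line graph `L_n`,
generated by `u_i = x_i x_{i+1} ⋯ x_{i+t-1}` for `1 ≤ i ≤ n - t + 1` (here written with
0-based indices). -/
noncomputable def pathIdeal (K : Type*) [Field K] (n t : ℕ) : Ideal (MvPolynomial (Fin n) K) :=
  Ideal.span ((pathGen K n t) '' {i : ℕ | i + t ≤ n})

/-- If membership in `Q` is tested by divisibility by `p ^ s` after applying the maps `φ c`
to a ring with a prime element `p`, and the conditions are separated by the elements `e c`, then
the associated primes of `R ⧸ Q` are the preimages of the ideal generated by `p`. -/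
theorem associatedPrimes_quotient_eq_of_forall_pow_dvd {R A ι : Type*} [CommRing R] [CommRing A]
    [IsDomain A] {p : A} (hp : Prime p) (F : Finset ι) (φ : ι → R →+* A) (s : ℕ) (hs : s ≠ 0)
    (Q : Ideal R) (hQ : ∀ f, f ∈ Q ↔ ∀ c ∈ F, p ^ s ∣ φ c f) (e : ι → R)
    (he : ∀ c ∈ F, ¬ p ∣ φ c (e c)) (he' : ∀ c ∈ F, ∀ d ∈ F, d ≠ c → p ∣ φ d (e c)) :
    associatedPrimes R (R ⧸ Q) = (fun c => (Ideal.span {p}).comap (φ c)) '' (F : Set ι) := by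
  have hprime : ∀ c, ((Ideal.span {p}).comap (φ c)).IsPrime := fun c => by
    have := (Ideal.span_singleton_prime hp.ne_zero).2 hp
    infer_instance
  have hrad : ∀ f g : R, g ∈ ((⊥ : Submodule R (R ⧸ Q)).colon {Ideal.Quotient.mk Q f}).radical ↔
      ∃ k, ∀ c ∈ F, p ^ s ∣ φ c g ^ k * φ c f := by
    intro f g
    simp only [Ideal.mem_radical_iff, Submodule.mem_colon_singleton, Submodule.mem_bot]
    refine exists_congr fun k => ?_
    have : g ^ k • Ideal.Quotient.mk Q f = Ideal.Quotient.mk Q (g ^ k * f) := rfl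
    rw [this, Ideal.Quotient.eq_zero_iff_mem, hQ]
    simp only [map_mul, map_pow]
  ext P
  constructor
  · rintro ⟨hP, x, hx⟩
    obtain ⟨f, rfl⟩ := Ideal.Quotient.mk_surjective x
    classical
    have hle : (F.filter fun c => ¬ p ^ s ∣ φ c f).inf
        (fun c => (Ideal.span {p}).comap (φ c)) ≤ P := by
      intro g hg
      rw [hx, hrad]
      refine ⟨s, fun c hc => ?_⟩
      by_cases h : p ^ s ∣ φ c f
      · exact h.mul_left _
      · have := (Finset.inf_le (f := fun c => (Ideal.span {p}).comap (φ c))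
          (Finset.mem_filter.2 ⟨hc, h⟩)) hg
        exact (pow_dvd_pow_of_dvd
          (Ideal.mem_span_singleton.1 (Ideal.mem_comap.1 this)) s).mul_right _
    obtain ⟨c, hc, hcP⟩ := (Ideal.IsPrime.inf_le' hP).1 hle
    obtain ⟨hcF, hcf⟩ := Finset.mem_filter.1 hc
    refine ⟨c, hcF, le_antisymm hcP fun g hg => ?_⟩
    rw [hx, hrad] at hg
    obtain ⟨k, hk⟩ := hg
    refine Ideal.mem_comap.2 (Ideal.mem_span_singleton.2 ?_)
    by_contra hpg
    exact hcf (hp.pow_dvd_of_dvd_mul_left s (fun h => hpg (hp.dvd_of_dvd_pow h)) (hk c hcF))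
  · rintro ⟨c, hc, rfl⟩
    refine ⟨hprime c, Ideal.Quotient.mk Q (e c ^ s), ?_⟩
    ext g
    rw [hrad, Ideal.mem_comap, Ideal.mem_span_singleton]
    constructor
    · intro hg
      refine ⟨s, fun d hd => ?_⟩
      rw [map_pow]
      by_cases h : d = c
      · subst h
        exact (pow_dvd_pow_of_dvd hg s).mul_right _
      · exact (pow_dvd_pow_of_dvd (he' c hc d hd h) s).mul_left _
    · rintro ⟨k, hk⟩
      have h := (dvd_pow_self p hs).trans (hk c hc)
      rw [map_pow] at h
      rcases hp.dvd_or_dvd h with h | h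
      · exact hp.dvd_of_dvd_pow h
      · exact absurd (hp.dvd_of_dvd_pow h) (he c hc)

/-- The homomorphism multiplying the variables in `C` by the new variable `T`, so that
`T`-divisibility measures the order of vanishing along `(x_j : j ∈ C)`. -/
noncomputable def scaleVars (K : Type*) [Field K] {n : ℕ} (C : Finset (Fin n)) :
    MvPolynomial (Fin n) K →+* Polynomial (MvPolynomial (Fin n) K) :=
  eval₂Hom (Polynomial.C.comp MvPolynomial.C)
    (fun j => if j ∈ C then Polynomial.C (X j) * Polynomial.X else Polynomial.C (X j))

section scaleVars

variable {K : Type*} [Field K] {n : ℕ} {C : Finset (Fin n)}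

theorem scaleVars_X (j : Fin n) : scaleVars K C (X j) =
    if j ∈ C then Polynomial.C (X j) * Polynomial.X else Polynomial.C (X j) := by
  simp [scaleVars]

theorem X_dvd_scaleVars_X {j : Fin n} :
    Polynomial.X ∣ scaleVars K C (X j) ↔ j ∈ C := by
  rw [scaleVars_X]
  split_ifs with h
  · simp [h]
  · simp [h, Polynomial.X_dvd_iff]

theorem scaleVars_monomial (m : Fin n →₀ ℕ) (a : K) :
    scaleVars K C (monomial m a) =
      Polynomial.C (monomial m a) * Polynomial.X ^ (∑ j ∈ C, m j) := by
  rw [scaleVars, coe_eval₂Hom, eval₂_monomial, Finsupp.prod_fintype _ _ (by simp)]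
  have : ∀ j, (if j ∈ C then Polynomial.C (X j) * Polynomial.X else Polynomial.C (X j)) ^ m j =
      Polynomial.C ((X j : MvPolynomial (Fin n) K) ^ m j) *
        (if j ∈ C then Polynomial.X ^ m j else 1) := by
    intro j
    split_ifs <;> simp [mul_pow]
  simp only [this, Finset.prod_mul_distrib]
  rw [Finset.prod_ite_mem, Finset.univ_inter, Finset.prod_pow_eq_pow_sum, ← map_prod, monomial_eq,
    Finsupp.prod_fintype _ _ (by simp)]
  simp [mul_assoc]

theorem coeff_coeff_scaleVars (f : MvPolynomial (Fin n) K) (m : Fin n →₀ ℕ) :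
    ((scaleVars K C f).coeff (∑ j ∈ C, m j)).coeff m = f.coeff m := by
  induction f using MvPolynomial.induction_on' with
  | monomial u a =>
    rw [scaleVars_monomial, Polynomial.coeff_C_mul_X_pow]
    by_cases h : u = m
    · simp [h]
    · split_ifs <;> simp [coeff_monomial, h]
  | add p q hp hq => simp [hp, hq]

theorem le_sum_of_X_pow_dvd_scaleVars {f : MvPolynomial (Fin n) K} {s : ℕ}
    (h : Polynomial.X ^ s ∣ scaleVars K C f) {m : Fin n →₀ ℕ} (hm : m ∈ f.support) :
    s ≤ ∑ j ∈ C, m j := by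
  by_contra! hlt
  rw [mem_support_iff, ← coeff_coeff_scaleVars (C := C), Polynomial.X_pow_dvd_iff.1 h _ hlt] at hm
  simp at hm

end scaleVars

/-- `C` meets every interval `[k, k + t)` with `k < i`. -/
def CoversBelow {n : ℕ} (t i : ℕ) (C : Finset (Fin n)) : Prop :=
  ∀ k < i, ∃ j ∈ C, k ≤ (j : ℕ) ∧ (j : ℕ) < k + t

/-- The least `m`-weight of a set meeting every interval `[k, k + t)` with `k < i`. -/
noncomputable def minCoverWeight {n : ℕ} (t : ℕ) (m : Fin n → ℕ) (i : ℕ) : ℕ :=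
  sInf ((fun C => ∑ j ∈ C, m j) '' {C | CoversBelow t i C})

section Cover

variable {n t : ℕ} {m : Fin n → ℕ} {i : ℕ}

theorem CoversBelow.univ (ht : 1 ≤ t) (hi : i + t ≤ n + 1) :
    CoversBelow t i (Finset.univ : Finset (Fin n)) :=
  fun k hk => ⟨⟨k, by omega⟩, Finset.mem_univ _, le_rfl, by simp; omega⟩

theorem CoversBelow.minCoverWeight_le {C : Finset (Fin n)} (hC : CoversBelow t i C) :
    minCoverWeight t m i ≤ ∑ j ∈ C, m j :=
  Nat.sInf_le ⟨C, hC, rfl⟩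

theorem exists_minCoverWeight_eq (ht : 1 ≤ t) (hi : i + t ≤ n + 1) :
    ∃ C : Finset (Fin n), CoversBelow t i C ∧ ∑ j ∈ C, m j = minCoverWeight t m i :=
  Nat.sInf_mem (s := (fun C => ∑ j ∈ C, m j) '' {C | CoversBelow t i C})
    ⟨_, _, CoversBelow.univ ht hi, rfl⟩

theorem minCoverWeight_zero : minCoverWeight t m 0 = 0 := by
  have : CoversBelow t 0 (∅ : Finset (Fin n)) := fun k hk => absurd hk (by omega)
  simpa using this.minCoverWeight_le (m := m)

theorem minCoverWeight_le_succ (ht : 1 ≤ t) (hi : i + t ≤ n) :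
    minCoverWeight t m i ≤ minCoverWeight t m (i + 1) := by
  obtain ⟨C, hC, h⟩ := exists_minCoverWeight_eq (m := m) (i := i + 1) ht (by omega)
  rw [← h]
  exact CoversBelow.minCoverWeight_le fun k hk => hC k (by omega)

theorem minCoverWeight_le_add (ht : 1 ≤ t) (j : Fin n) {b : ℕ} (hb : b ≤ j + 1)
    (hi : (j + 1 - t) + t ≤ n + 1) :
    minCoverWeight t m b ≤ minCoverWeight t m (j + 1 - t) + m j := by
  obtain ⟨C, hC, h⟩ := exists_minCoverWeight_eq (m := m) (i := j + 1 - t) ht hi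
  rw [← h]
  have hcov : CoversBelow t b (insert j C) := by
    intro k hk
    by_cases hkj : k < j + 1 - t
    · obtain ⟨l, hl, h⟩ := hC k hkj
      exact ⟨l, Finset.mem_insert_of_mem hl, h⟩
    · exact ⟨j, Finset.mem_insert_self _ _, by omega, by omega⟩
  refine hcov.minCoverWeight_le.trans ?_
  by_cases hj : j ∈ C
  · rw [Finset.insert_eq_of_mem hj]
    omega
  · rw [Finset.sum_insert hj]
    omega

end Cover

section PathIdeal

variable {K : Type*} [Field K] {n t : ℕ}

theorem prod_pathGen_pow_dvd_monomial (ht : 1 ≤ t) (htn : t ≤ n) (m : Fin n →₀ ℕ) :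
    ∏ i ∈ Finset.range (n + 1 - t),
      pathGen K n t i ^ (minCoverWeight t m (i + 1) - minCoverWeight t m i) ∣ monomial m 1 := by
  have hprod : ∏ i ∈ Finset.range (n + 1 - t),
      pathGen K n t i ^ (minCoverWeight t m (i + 1) - minCoverWeight t m i) =
      ∏ j : Fin n, X j ^ (∑ i ∈ Finset.Ico ((j : ℕ) + 1 - t) (min ((j : ℕ) + 1) (n + 1 - t)),
        (minCoverWeight t m (i + 1) - minCoverWeight t m i)) := by
    simp only [pathGen, ← Finset.prod_pow, ← Finset.prod_pow_eq_pow_sum]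
    refine Finset.prod_comm' fun i j => ?_
    simp only [Finset.mem_range, Finset.mem_filter, Finset.mem_univ, Finset.mem_Ico, true_and, and_true,
      lt_min_iff]
    omega
  rw [hprod, monomial_eq, map_one, one_mul, Finsupp.prod_fintype _ _ (by simp)]
  refine Finset.prod_dvd_prod_of_dvd _ _ fun j _ => pow_dvd_pow _ ?_
  have hj := j.2
  have hab : (j : ℕ) + 1 - t ≤ min ((j : ℕ) + 1) (n + 1 - t) := by omega
  have hsum : ∀ b, (j : ℕ) + 1 - t ≤ b → b ≤ n + 1 - t →
      ∑ i ∈ Finset.Ico ((j : ℕ) + 1 - t) b, (minCoverWeight t m (i + 1) - minCoverWeight t m i) +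
        minCoverWeight t m (j + 1 - t) = minCoverWeight t m b := by
    intro b hb
    induction b, hb using Nat.le_induction with
    | base => simp
    | succ b hb ih =>
      intro hbn
      have h1 := ih (by omega)
      have h2 := minCoverWeight_le_succ (m := m) (i := b) ht (by omega)
      rw [Finset.sum_Ico_succ_top hb]
      omega
  have h1 := hsum _ hab (by omega)
  have h2 := minCoverWeight_le_add (m := m) ht j (b := min ((j : ℕ) + 1) (n + 1 - t)) (by omega)
    (by omega)
  omega

theorem monomial_mem_pathIdeal_pow (ht : 1 ≤ t) (htn : t ≤ n) (m : Fin n →₀ ℕ) :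
    monomial m 1 ∈ pathIdeal K n t ^ minCoverWeight t m (n + 1 - t) := by
  refine Ideal.mem_of_dvd _ (prod_pathGen_pow_dvd_monomial ht htn m) ?_
  have key : ∀ b ≤ n + 1 - t, ∏ i ∈ Finset.range b,
      pathGen K n t i ^ (minCoverWeight t m (i + 1) - minCoverWeight t m i) ∈
        pathIdeal K n t ^ minCoverWeight t m b := by
    intro b
    induction b with
    | zero => simp [minCoverWeight_zero]
    | succ b ih =>
      intro hb
      have hmem : pathGen K n t b ∈ pathIdeal K n t :=
        Ideal.subset_span ⟨b, by simp only [Set.mem_ofPred_eq]; omega, rfl⟩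
      have h := Ideal.mul_mem_mul (ih (by omega)) (Ideal.pow_mem_pow hmem
        (minCoverWeight t m (b + 1) - minCoverWeight t m b))
      rwa [← pow_add, Nat.add_sub_cancel' (minCoverWeight_le_succ ht (by omega)),
        ← Finset.prod_range_succ] at h
  exact key _ le_rfl

theorem pathIdeal_pow_le_comap_scaleVars {C : Finset (Fin n)}
    (hC : CoversBelow t (n + 1 - t) C) (s : ℕ) :
    pathIdeal K n t ^ s ≤ (Ideal.span {Polynomial.X ^ s}).comap (scaleVars K C) := by
  have h1 : pathIdeal K n t ≤ (Ideal.span {Polynomial.X}).comap (scaleVars K C) := by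
    refine Ideal.span_le.2 ?_
    rintro _ ⟨i, hi, rfl⟩
    obtain ⟨j, hj, hij⟩ := hC i (by simp only [Set.mem_ofPred_eq] at hi; omega)
    refine Ideal.mem_comap.2 (Ideal.mem_span_singleton.2 ?_)
    rw [pathGen, map_prod]
    exact (X_dvd_scaleVars_X.2 hj).trans (Finset.dvd_prod_of_mem _ (by simpa using hij))
  rw [← Ideal.span_singleton_pow]
  exact (Ideal.pow_right_mono h1 s).trans (Ideal.le_comap_pow _ s)

theorem mem_pathIdeal_pow_iff (ht : 1 ≤ t) (htn : t ≤ n) (s : ℕ) (f : MvPolynomial (Fin n) K) :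
    f ∈ pathIdeal K n t ^ s ↔ ∀ C : Finset (Fin n), Minimal (CoversBelow t (n + 1 - t)) C →
      Polynomial.X ^ s ∣ scaleVars K C f := by
  constructor
  · intro hf C hC
    exact Ideal.mem_span_singleton.1 (pathIdeal_pow_le_comap_scaleVars hC.prop s hf)
  · intro h
    rw [f.as_sum]
    refine Ideal.sum_mem _ fun m hm => ?_
    have hs : s ≤ minCoverWeight t m (n + 1 - t) := by
      obtain ⟨C, hC, hCm⟩ := exists_minCoverWeight_eq (m := m) (i := n + 1 - t) ht (by omega)
      obtain ⟨D, hDC, hD⟩ := exists_minimal_le_of_wellFoundedLT _ C hC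
      rw [← hCm]
      exact (le_sum_of_X_pow_dvd_scaleVars (h D hD) hm).trans
        (Finset.sum_le_sum_of_subset hDC)
    have := Ideal.mul_mem_left _ (MvPolynomial.C (f.coeff m))
      (Ideal.pow_le_pow_right hs (monomial_mem_pathIdeal_pow (K := K) ht htn m))
    rwa [C_mul_monomial, mul_one] at this

theorem associatedPrimes_quotient_pathIdeal_pow (ht : 1 ≤ t) (htn : t ≤ n) (s : ℕ) (hs : s ≠ 0) :
    associatedPrimes (MvPolynomial (Fin n) K) (MvPolynomial (Fin n) K ⧸ (pathIdeal K n t ^ s)) =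
      (fun C : Finset (Fin n) => (Ideal.span {Polynomial.X}).comap (scaleVars K C)) ''
        {C | Minimal (CoversBelow t (n + 1 - t)) C} := by
  classical
  have := associatedPrimes_quotient_eq_of_forall_pow_dvd Polynomial.prime_X
    (Finset.univ.filter fun C : Finset (Fin n) => Minimal (CoversBelow t (n + 1 - t)) C)
    (scaleVars K) s hs (pathIdeal K n t ^ s)
    (fun f => by simpa using mem_pathIdeal_pow_iff ht htn s f) (fun C => ∏ j ∈ Cᶜ, X j) ?_ ?_
  · simpa using this
  · intro C _ h
    rw [map_prod, Polynomial.prime_X.dvd_finsetProd_iff] at h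
    obtain ⟨j, hj, h⟩ := h
    exact Finset.mem_compl.1 hj (X_dvd_scaleVars_X.1 h)
  · intro C hC D hD hne
    simp only [Finset.mem_filter, Finset.mem_univ, true_and] at hC hD
    obtain ⟨j, hjD, hjC⟩ := Finset.not_subset.1 fun h => hne (hC.eq_of_le hD.prop h)
    rw [map_prod]
    exact (X_dvd_scaleVars_X.2 hjD).trans
      (Finset.dvd_prod_of_mem _ (Finset.mem_compl.2 hjC))

end PathIdeal

/-- `I_t(L_n)` is normally torsion-free: for every `s ≥ 1`, the associated primes of
`S/I_t(L_n)^s` coincide with those of `S/I_t(L_n)`. -/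
theorem pathIdeal_normally_torsion_free (K : Type*) [Field K] (n t : ℕ)
    (ht : 2 ≤ t) (htn : t ≤ n) (s : ℕ) (hs : 1 ≤ s) :
    associatedPrimes (MvPolynomial (Fin n) K) (MvPolynomial (Fin n) K ⧸ (pathIdeal K n t ^ s)) =
      associatedPrimes (MvPolynomial (Fin n) K) (MvPolynomial (Fin n) K ⧸ (pathIdeal K n t)) := by
  have h := associatedPrimes_quotient_pathIdeal_pow (K := K) (by omega : 1 ≤ t) htn
  rw [h s (by omega), ← h 1 one_ne_zero, pow_one]
end

section
/- Let K be a field, 2 ≤ t ≤ n, and S = K[x_1,…,x_n]. Call a subset C of {1,…,n} a vertex cover (for t-paths) if C ∩ {i, i+1, …, i+t−1} ≠ ∅ for every 1 ≤ i ≤ n−t+1, and let J = I_t(L_n)^∨ be the Alexander dual of the t-path ideal, namely the ideal of S generated by the squarefree monomials ∏_{i∈C} x_i as C ranges over all vertex covers. Then J is normally torsion-free: for every s ≥ 1, the set of associated primes of the S-module S/J^s equals the set of associated primes of S/J. -/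
open MvPolynomial

/-- A subset `C` of the (0-based) vertices `{0,…,n-1}` is a vertex cover for `t`-paths if it
meets every interval `{i, i+1, …, i+t-1}` with `i + t ≤ n`. -/
def IsPathCover (n t : ℕ) (C : Finset (Fin n)) : Prop :=
  ∀ i : ℕ, i + t ≤ n → ∃ j ∈ C, i ≤ (j : ℕ) ∧ (j : ℕ) < i + t

/-- The Alexander dual `I_t(L_n)^∨` of the `t`-path ideal: the ideal generated by the
squarefree monomials `∏_{i ∈ C} x_i` as `C` ranges over all vertex covers for `t`-paths. -/
noncomputable def pathDualIdeal (K : Type*) [Field K] (n t : ℕ) :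
    Ideal (MvPolynomial (Fin n) K) :=
  Ideal.span ((fun C : Finset (Fin n) => ∏ j ∈ C, X j) '' {C | IsPathCover n t C})

section VariableOrder

variable {σ R : Type*} [CommRing R]

/-- The order of a polynomial along the prime `(x_j : j ∈ A)`: the least total degree in the
variables of `A` among its monomials. -/
noncomputable def variableOrder (A : Finset σ) (f : MvPolynomial σ R) : ℕ∞ :=
  (f : MvPowerSeries σ R).weightedOrder ((A : Set σ).indicator 1)

theorem weight_indicator_one (A : Finset σ) (d : σ →₀ ℕ) :
    Finsupp.weight ((A : Set σ).indicator (1 : σ → ℕ)) d = ∑ j ∈ A, d j := by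
  classical
  rw [Finsupp.weight_apply, Finsupp.sum_of_support_subset (s := d.support ∪ A) d
    Finset.subset_union_left _ (by simp)]
  simp only [Set.indicator_apply, Finset.mem_coe, Pi.one_apply, smul_eq_mul, mul_ite, mul_one,
    mul_zero, Finset.sum_ite_mem]
  rw [Finset.union_inter_cancel_right]

theorem le_variableOrder_iff {A : Finset σ} {f : MvPolynomial σ R} {s : ℕ} :
    (s : ℕ∞) ≤ variableOrder A f ↔ ∀ d ∈ f.support, s ≤ ∑ j ∈ A, d j := by
  constructor
  · intro h d hd
    have := h.trans (MvPowerSeries.weightedOrder_le _ (d := d)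
      (by rwa [coeff_coe, ← mem_support_iff]))
    rw [weight_indicator_one] at this
    exact_mod_cast this
  · intro h
    refine MvPowerSeries.nat_le_weightedOrder _ fun d hd => ?_
    rw [weight_indicator_one] at hd
    rw [coeff_coe]
    by_contra hne
    exact (h d (mem_support_iff.mpr hne)).not_gt hd

theorem one_le_variableOrder_iff {A : Finset σ} {f : MvPolynomial σ R} :
    1 ≤ variableOrder A f ↔ f ∈ Ideal.span (X '' (A : Set σ) : Set (MvPolynomial σ R)) := by
  rw [mem_ideal_span_X_image, ← Nat.cast_one, le_variableOrder_iff]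
  simp only [Nat.one_le_iff_ne_zero, ne_eq, Finset.sum_eq_zero_iff, not_forall, exists_prop,
    Finset.mem_coe]

theorem variableOrder_mul [NoZeroDivisors R] (A : Finset σ) (f g : MvPolynomial σ R) :
    variableOrder A (f * g) = variableOrder A f + variableOrder A g := by
  rw [variableOrder, coe_mul, MvPowerSeries.weightedOrder_mul]
  rfl

theorem variableOrder_one [Nontrivial R] (A : Finset σ) :
    variableOrder A (1 : MvPolynomial σ R) = 0 := by
  rw [variableOrder, coe_one, MvPowerSeries.weightedOrder_one]

theorem variableOrder_pow [NoZeroDivisors R] [Nontrivial R] (A : Finset σ) (f : MvPolynomial σ R)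
    (s : ℕ) : variableOrder A (f ^ s) = s * variableOrder A f := by
  induction s with
  | zero => simp [variableOrder_one]
  | succ s ih => rw [pow_succ, variableOrder_mul, ih, Nat.cast_succ, add_mul, one_mul]

theorem variableOrder_prod [NoZeroDivisors R] [Nontrivial R] {ι : Type*} (A : Finset σ)
    (B : Finset ι) (f : ι → MvPolynomial σ R) :
    variableOrder A (∏ j ∈ B, f j) = ∑ j ∈ B, variableOrder A (f j) := by
  classical
  induction B using Finset.induction_on with
  | empty => simp [variableOrder_one]
  | insert a B ha ih => rw [Finset.prod_insert ha, variableOrder_mul, ih, Finset.sum_insert ha]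

theorem variableOrder_X [Nontrivial R] [DecidableEq σ] (A : Finset σ) (j : σ) :
    variableOrder A (X j : MvPolynomial σ R) = if j ∈ A then 1 else 0 := by
  rw [variableOrder, coe_X, MvPowerSeries.X, MvPowerSeries.weightedOrder_monomial_of_ne_zero _
    one_ne_zero, weight_indicator_one]
  simp [Finsupp.single_apply]

/-- The polynomials of order at least `s` along `(x_j : j ∈ A)`. -/
noncomputable def variableOrderIdeal (R : Type*) [CommRing R] (A : Finset σ) (s : ℕ) :
    Ideal (MvPolynomial σ R) where
  carrier := {f | (s : ℕ∞) ≤ variableOrder A f}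
  add_mem' {f g} hf hg := by
    rw [Set.mem_ofPred_eq] at hf hg ⊢
    refine (le_min hf hg).trans ?_
    simp only [variableOrder, coe_add]
    exact MvPowerSeries.min_weightedOrder_le_add _
  zero_mem' := by simp [variableOrder]
  smul_mem' c f hf := by
    rw [Set.mem_ofPred_eq] at hf ⊢
    refine le_trans (hf.trans (le_add_self (a := variableOrder A f) (b := variableOrder A c))) ?_
    simp only [variableOrder, smul_eq_mul, coe_mul]
    exact MvPowerSeries.le_weightedOrder_mul _

theorem mem_variableOrderIdeal {A : Finset σ} {s : ℕ} {f : MvPolynomial σ R} :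
    f ∈ variableOrderIdeal R A s ↔ (s : ℕ∞) ≤ variableOrder A f := Iff.rfl

theorem pow_le_variableOrderIdeal [NoZeroDivisors R] {A : Finset σ} {J : Ideal (MvPolynomial σ R)}
    (hJ : J ≤ variableOrderIdeal R A 1) (s : ℕ) : J ^ s ≤ variableOrderIdeal R A s := by
  induction s with
  | zero => exact fun f _ => by simp [mem_variableOrderIdeal]
  | succ s ih =>
    rw [pow_succ, Ideal.mul_le]
    intro f hf g hg
    rw [mem_variableOrderIdeal, variableOrder_mul, Nat.cast_succ]
    exact add_le_add (ih hf) (by simpa [mem_variableOrderIdeal] using hJ hg)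

end VariableOrder

theorem colon_bot_mk {R : Type*} [CommRing R] (I : Ideal R) (x f : R) :
    x ∈ (⊥ : Submodule R (R ⧸ I)).colon {Ideal.Quotient.mk I f} ↔ x * f ∈ I := by
  rw [Submodule.mem_colon_singleton, Submodule.mem_bot, Algebra.smul_def,
    Ideal.Quotient.algebraMap_eq, ← map_mul, Ideal.Quotient.eq_zero_iff_mem]

/-- The associated primes of an intersection of symbolic powers of the primes generated by an
antichain of sets of variables. -/
theorem associatedPrimes_eq_of_mem_iff_variableOrder {σ ι K : Type*} [Field K] [Finite σ]
    [Finite ι] {A : ι → Finset σ} (hne : ∀ i, (A i).Nonempty)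
    (hA : ∀ i k, A k ⊆ A i → k = i) {s : ℕ} (hs : 1 ≤ s) {J : Ideal (MvPolynomial σ K)}
    (hJ : ∀ f, f ∈ J ↔ ∀ i, (s : ℕ∞) ≤ variableOrder (A i) f) :
    associatedPrimes (MvPolynomial σ K) (MvPolynomial σ K ⧸ J) =
      Set.range fun i => Ideal.span (X '' (A i : Set σ) : Set (MvPolynomial σ K)) := by
  classical
  have := Fintype.ofFinite ι
  have := Fintype.ofFinite σ
  ext Q
  rw [AssociatedPrimes.mem_iff, isAssociatedPrime_iff]
  constructor
  · rintro ⟨hQ, q, hq⟩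
    obtain ⟨f, rfl⟩ := Ideal.Quotient.mk_surjective q
    have hmem : ∀ x, x ∈ Q ↔ ∀ i, (s : ℕ∞) ≤ variableOrder (A i) x + variableOrder (A i) f := by
      intro x
      rw [hq, colon_bot_mk, hJ]
      simp only [variableOrder_mul]
    by_contra hcon
    have key : ∀ i, ∃ y ∉ Q, (s : ℕ∞) ≤ variableOrder (A i) y + variableOrder (A i) f := by
      intro i
      by_cases hi : (s : ℕ∞) ≤ variableOrder (A i) f
      · exact ⟨1, (Ideal.ne_top_iff_one Q).mp hQ.ne_top, hi.trans le_add_self⟩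
      have hle : Q ≤ Ideal.span (X '' (A i : Set σ)) := by
        intro x hx
        rw [← one_le_variableOrder_iff, Order.one_le_iff_ne_zero]
        intro h0
        have := (hmem x).mp hx i
        rw [h0, zero_add] at this
        exact hi this
      obtain ⟨y, hy, hyQ⟩ := Set.not_subset.mp fun h => hcon ⟨i, le_antisymm h hle⟩
      refine ⟨y ^ s, fun h => hyQ (hQ.mem_of_pow_mem s h), ?_⟩
      rw [variableOrder_pow]
      refine le_trans ?_ le_self_add
      exact le_mul_of_one_le_right' (one_le_variableOrder_iff.mpr hy)
    choose y hyQ hy using key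
    have hprod : ∏ i, y i ∈ Q := by
      rw [hmem]
      intro i
      refine (hy i).trans ?_
      gcongr
      rw [variableOrder_prod]
      exact Finset.single_le_sum (f := fun k => variableOrder (A i) (y k))
        (fun _ _ => zero_le) (Finset.mem_univ i)
    obtain ⟨i, -, hi⟩ := (hQ.prod_mem_iff).mp hprod
    exact hyQ i hi
  · rintro ⟨i, rfl⟩
    refine ⟨?_, ?_⟩
    · refine ⟨?_, ?_⟩
      · rw [Ideal.ne_top_iff_one, ← one_le_variableOrder_iff, variableOrder_one]
        simp
      · intro x y hxy
        rw [← one_le_variableOrder_iff, variableOrder_mul, Order.one_le_iff_ne_zero] at hxy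
        rw [← one_le_variableOrder_iff, ← one_le_variableOrder_iff, Order.one_le_iff_ne_zero,
          Order.one_le_iff_ne_zero]
        by_contra! h
        exact hxy (by rw [h.1, h.2, add_zero])
    · obtain ⟨j₀, hj₀⟩ := hne i
      obtain ⟨r, rfl⟩ : ∃ r, s = r + 1 := ⟨s - 1, by omega⟩
      set f : MvPolynomial σ K := X j₀ ^ r * ∏ j ∈ (A i)ᶜ, X j ^ (r + 1) with hf
      have hfi : variableOrder (A i) f = r := by
        rw [hf, variableOrder_mul, variableOrder_pow, variableOrder_X, if_pos hj₀,
          variableOrder_prod, Finset.sum_eq_zero, mul_one, add_zero]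
        intro j hj
        rw [variableOrder_pow, variableOrder_X, if_neg (Finset.mem_compl.mp hj), mul_zero]
      have hfk : ∀ k ≠ i, ((r + 1 : ℕ) : ℕ∞) ≤ variableOrder (A k) f := by
        intro k hk
        obtain ⟨j, hjk, hji⟩ := Finset.not_subset.mp fun h => hk (hA i k h)
        rw [hf, variableOrder_mul, variableOrder_prod]
        refine le_trans ?_ le_add_self
        refine le_trans ?_ (Finset.single_le_sum
          (f := fun l => variableOrder (A k) (X l ^ (r + 1) : MvPolynomial σ K))
          (fun _ _ => zero_le) (Finset.mem_compl.mpr hji))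
        simp only [variableOrder_pow, variableOrder_X, if_pos hjk, mul_one, le_refl]
      refine ⟨Ideal.Quotient.mk J f, ?_⟩
      ext x
      rw [colon_bot_mk, hJ, ← one_le_variableOrder_iff]
      simp only [variableOrder_mul]
      constructor
      · intro hx k
        by_cases hk : k = i
        · subst hk
          rw [hfi, Nat.cast_succ, add_comm]
          gcongr
        · exact (hfk k hk).trans le_add_self
      · intro hx
        have := hx i
        rw [hfi, Nat.cast_succ, add_comm] at this
        exact (ENat.add_le_add_iff_right (ENat.natCast_ne_top r)).mp this

/-- The interval `{i, …, i + t - 1}` of vertices. -/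
def pathInterval (n t i : ℕ) : Finset (Fin n) :=
  {j | i ≤ (j : ℕ) ∧ (j : ℕ) < i + t}

theorem mem_pathInterval {n t i : ℕ} {j : Fin n} :
    j ∈ pathInterval n t i ↔ i ≤ (j : ℕ) ∧ (j : ℕ) < i + t := by
  simp [pathInterval]

theorem sum_pathInterval {n t i : ℕ} (h : i + t ≤ n) (e : ℕ → ℕ) :
    ∑ j ∈ pathInterval n t i, e j = ∑ l ∈ Finset.Ico i (i + t), e l := by
  refine Finset.sum_bij (fun j _ => (j : ℕ)) ?_ ?_ ?_ ?_
  · intro j hj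
    simpa [mem_pathInterval] using hj
  · intro j _ k _ hjk
    exact Fin.ext hjk
  · intro l hl
    rw [Finset.mem_Ico] at hl
    exact ⟨⟨l, by omega⟩, mem_pathInterval.mpr hl, rfl⟩
  · intros
    rfl

/-- A multiset of vertices with at least `s` members in every interval contains `s` disjoint
path covers: number its members from left to right and colour them cyclically. -/
theorem exists_pathCovers {n t s : ℕ} (hs : 1 ≤ s) (d : Fin n → ℕ)
    (hd : ∀ i, i + t ≤ n → s ≤ ∑ j ∈ pathInterval n t i, d j) :
    ∃ D : Fin s → Finset (Fin n), (∀ k, IsPathCover n t (D k)) ∧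
      ∀ j, (Finset.univ.filter fun k => j ∈ D k).card ≤ d j := by
  classical
  let e : ℕ → ℕ := fun l => if h : l < n then d ⟨l, h⟩ else 0
  have he : ∀ j : Fin n, e j = d j := fun j => by simp [e]
  let S : ℕ → ℕ := fun l => ∑ m ∈ Finset.range l, e m
  have hS : ∀ l, S (l + 1) = S l + e l := fun l => Finset.sum_range_succ e l
  refine ⟨fun k => {j | ∃ u, S j ≤ u ∧ u < S (j + 1) ∧ u % s = k}, fun k i hi => ?_, fun j => ?_⟩
  · have hlen : S i + s ≤ S (i + t) := by
      have h := hd i hi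
      simp only [← he] at h
      rw [sum_pathInterval hi] at h
      have := Finset.sum_range_add_sum_Ico e (Nat.le_add_right i t)
      simp only [S]
      omega
    obtain ⟨u, hu₁, hu₂, hu⟩ : ∃ u, S i ≤ u ∧ u < S i + s ∧ u % s = k := by
      obtain ⟨u, hu, huk⟩ := Finset.mem_image.mp
        ((Nat.image_Ico_mod (S i) s).symm ▸ Finset.mem_range.mpr k.isLt)
      exact ⟨u, (Finset.mem_Ico.mp hu).1, (Finset.mem_Ico.mp hu).2, huk⟩
    have hex : ∃ l, u < S (i + l + 1) := ⟨t, by rw [hS]; omega⟩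
    set l := Nat.find hex with hl
    have hl₁ : u < S (i + l + 1) := Nat.find_spec hex
    have hlt : l < t := by
      rcases t with _ | t
      · simp at hlen; omega
      · exact Nat.lt_succ_of_le (Nat.find_min' hex (by rw [add_assoc]; omega))
    have hl₀ : S (i + l) ≤ u := by
      rcases h : l with _ | m
      · simpa using hu₁
      · exact not_lt.mp (Nat.find_min hex (m := m) (by omega))
    refine ⟨⟨i + l, by omega⟩, ?_, by simp, by simpa using hlt⟩
    rw [Finset.mem_filter]
    exact ⟨Finset.mem_univ _, u, hl₀, hl₁, hu⟩
  · have hsub : (Finset.univ.filter fun k : Fin s =>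
        ∃ u, S j ≤ u ∧ u < S (j + 1) ∧ u % s = k) ⊆
        (Finset.Ico (S j) (S (j + 1))).image fun u => (⟨u % s, Nat.mod_lt _ hs⟩ : Fin s) := by
      intro k hk
      obtain ⟨-, u, h₁, h₂, h₃⟩ := Finset.mem_filter.mp hk
      exact Finset.mem_image.mpr ⟨u, Finset.mem_Ico.mpr ⟨h₁, h₂⟩, Fin.ext h₃⟩
    have := (Finset.card_le_card hsub).trans Finset.card_image_le
    rw [Nat.card_Ico, Nat.sub_eq_of_eq_add' (hS j), he] at this
    simpa using this

theorem mem_pathDualIdeal_pow_iff {K : Type*} [Field K] {n t s : ℕ} (hs : 1 ≤ s)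
    (f : MvPolynomial (Fin n) K) :
    f ∈ pathDualIdeal K n t ^ s ↔
      ∀ i, i + t ≤ n → (s : ℕ∞) ≤ variableOrder (pathInterval n t i) f := by
  classical
  constructor
  · intro hf i hi
    refine pow_le_variableOrderIdeal (Ideal.span_le.mpr ?_) s hf
    rintro _ ⟨C, hC, rfl⟩
    obtain ⟨j, hj, hji⟩ := hC i hi
    rw [SetLike.mem_coe, mem_variableOrderIdeal, Nat.cast_one, one_le_variableOrder_iff]
    exact Ideal.mem_of_dvd _ (Finset.dvd_prod_of_mem _ hj)
      (Ideal.subset_span ⟨j, mem_pathInterval.mpr hji, rfl⟩)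
  · intro hf
    rw [f.as_sum]
    refine Ideal.sum_mem _ fun d hd => ?_
    obtain ⟨D, hD, hDd⟩ := exists_pathCovers hs d
      fun i hi => le_variableOrder_iff.mp (hf i hi) d hd
    have hmem : ∏ k, ∏ j ∈ D k, (X j : MvPolynomial (Fin n) K) ∈ pathDualIdeal K n t ^ s := by
      have := Ideal.prod_mem_prod (s := Finset.univ) (I := fun _ : Fin s => pathDualIdeal K n t)
        (x := fun k => ∏ j ∈ D k, X j) fun k _ => Ideal.subset_span ⟨D k, hD k, rfl⟩
      simpa using this
    refine Ideal.mem_of_dvd _ ?_ hmem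
    have hprod : ∏ k, ∏ j ∈ D k, (X j : MvPolynomial (Fin n) K) =
        ∏ j, X j ^ (Finset.univ.filter fun k => j ∈ D k).card := by
      rw [Finset.prod_comm' (t' := Finset.univ) (s' := fun j => Finset.univ.filter (j ∈ D ·))
        (by simp)]
      simp
    rw [hprod, monomial_eq, Finsupp.prod_fintype _ _ (by simp)]
    exact (Finset.prod_dvd_prod_of_dvd _ _ fun j _ => pow_dvd_pow _ (hDd j)).mul_left _

/-- The Alexander dual of `I_t(L_n)` is normally torsion-free: for every `s ≥ 1`, the
associated primes of `S/J^s` coincide with those of `S/J`, where `J = I_t(L_n)^∨`. -/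
theorem pathDualIdeal_normally_torsion_free (K : Type*) [Field K] (n t : ℕ)
    (ht : 2 ≤ t) (htn : t ≤ n) (s : ℕ) (hs : 1 ≤ s) :
    associatedPrimes (MvPolynomial (Fin n) K)
        (MvPolynomial (Fin n) K ⧸ (pathDualIdeal K n t ^ s)) =
      associatedPrimes (MvPolynomial (Fin n) K)
        (MvPolynomial (Fin n) K ⧸ (pathDualIdeal K n t)) := by
  have hne : ∀ i : Fin (n + 1 - t), (pathInterval n t i).Nonempty := fun i =>
    ⟨⟨i, by omega⟩, mem_pathInterval.mpr (by simp; omega)⟩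
  have hA : ∀ i k : Fin (n + 1 - t), pathInterval n t k ⊆ pathInterval n t i → k = i := by
    intro i k h
    have h₁ := mem_pathInterval.mp (h (mem_pathInterval (j := ⟨k, by omega⟩).mpr (by simp; omega)))
    have h₂ := mem_pathInterval.mp
      (h (mem_pathInterval (j := ⟨k + t - 1, by omega⟩).mpr (by simp; omega)))
    simp only at h₁ h₂
    exact Fin.ext (by omega)
  have hprimes : ∀ r, 1 ≤ r → associatedPrimes (MvPolynomial (Fin n) K)
      (MvPolynomial (Fin n) K ⧸ (pathDualIdeal K n t ^ r)) =
        Set.range fun i : Fin (n + 1 - t) =>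
          Ideal.span (X '' (pathInterval n t i : Set (Fin n)) : Set (MvPolynomial (Fin n) K)) := by
    intro r hr
    refine associatedPrimes_eq_of_mem_iff_variableOrder hne hA hr fun f => ?_
    rw [mem_pathDualIdeal_pow_iff hr]
    exact ⟨fun h i => h i (by omega), fun h i hi => h ⟨i, by omega⟩⟩
  have hone := hprimes 1 le_rfl
  rw [pow_one] at hone
  rw [hprimes s hs, hone]
end

section
/- Let K be a field, 1 ≤ t ≤ n, and S = K[x_1,…,x_n]. The set of minimal prime ideals of the t-path ideal I_t(L_n) is exactly { p_F : F ∈ C_{n,t} }, where p_F = (x_i : i ∈ F). -/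
open MvPolynomial

/-- The collection `C_{n,t}` of subsets `{i₁ < i₂ < ⋯ < i_r}` of `{1,…,n}` with
(1) `i₁ ≤ t`; (2) `i₂ > t`; (3) `i_{j+1} - i_j ≤ t`; (4) `i_{j+2} - i_j > t`;
(5) `i_{r-1} < n - t + 1`; (6) `n - t + 1 ≤ i_r ≤ n`. -/
def memC (n t : ℕ) (F : Finset ℕ) : Prop :=
  ∃ (r : ℕ) (hr : 1 ≤ r) (f : Fin r → ℕ),
    StrictMono f ∧ F = Finset.image f Finset.univ ∧
    (∀ j, 1 ≤ f j ∧ f j ≤ n) ∧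
    f ⟨0, by omega⟩ ≤ t ∧
    (∀ h : 1 < r, t < f ⟨1, h⟩) ∧
    (∀ j : ℕ, ∀ h : j + 1 < r, f ⟨j + 1, h⟩ - f ⟨j, by omega⟩ ≤ t) ∧
    (∀ j : ℕ, ∀ h : j + 2 < r, t < f ⟨j + 2, h⟩ - f ⟨j, by omega⟩) ∧
    (∀ _ : 2 ≤ r, f ⟨r - 2, by omega⟩ < n - t + 1) ∧
    n - t + 1 ≤ f ⟨r - 1, by omega⟩

/-- The monomial prime ideal `p_F = (x_i : i ∈ F)` for `F ⊆ {1,…,n}` (1-based). -/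
noncomputable def pF (K : Type*) [Field K] (n : ℕ) (F : Finset ℕ) :
    Ideal (MvPolynomial (Fin n) K) :=
  Ideal.span ((fun j : Fin n => X j) '' {j : Fin n | (j : ℕ) + 1 ∈ F})

/-- The `K`-algebra endomorphism killing the variables indexed by `F` (1-based) and fixing the
others. -/
noncomputable def killVars (K : Type*) [Field K] (n : ℕ) (F : Finset ℕ) :
    MvPolynomial (Fin n) K →ₐ[K] MvPolynomial (Fin n) K :=
  aeval fun j : Fin n => if (j : ℕ) + 1 ∈ F then 0 else X j

lemma sub_killVars_mem_pF (K : Type*) [Field K] (n : ℕ) (F : Finset ℕ)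
    (p : MvPolynomial (Fin n) K) : p - killVars K n F p ∈ pF K n F := by
  induction p using MvPolynomial.induction_on with
  | C a => simp [killVars]
  | add p q hp hq =>
    rw [map_add, add_sub_add_comm]
    exact add_mem hp hq
  | mul_X p j hp =>
    rw [map_mul]
    by_cases hj : (j : ℕ) + 1 ∈ F
    · have h : killVars K n F (X j) = 0 := by simp [killVars, hj]
      rw [h, mul_zero, sub_zero]
      exact Ideal.mul_mem_left _ _ (Ideal.subset_span ⟨j, hj, rfl⟩)
    · have h : killVars K n F (X j) = X j := by simp [killVars, hj]
      rw [h, ← sub_mul]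
      exact Ideal.mul_mem_right _ _ hp

lemma pF_eq_ker (K : Type*) [Field K] (n : ℕ) (F : Finset ℕ) :
    pF K n F = RingHom.ker (killVars K n F) := by
  apply le_antisymm
  · rw [pF, Ideal.span_le]
    rintro _ ⟨j, hj, rfl⟩
    have hj' : (j : ℕ) + 1 ∈ F := hj
    simp [killVars, RingHom.mem_ker, hj']
  · intro p hp
    have h := sub_killVars_mem_pF K n F p
    rwa [RingHom.mem_ker.mp hp, sub_zero] at h

lemma pF_isPrime (K : Type*) [Field K] (n : ℕ) (F : Finset ℕ) : (pF K n F).IsPrime := by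
  rw [pF_eq_ker]
  exact RingHom.ker_isPrime _

lemma X_mem_pF (K : Type*) [Field K] {n : ℕ} {F : Finset ℕ} {j : Fin n} :
    X j ∈ pF K n F ↔ (j : ℕ) + 1 ∈ F := by
  rw [pF_eq_ker, RingHom.mem_ker]
  by_cases hj : (j : ℕ) + 1 ∈ F <;> simp [killVars, hj]

/-- `F` meets every set of `t` consecutive elements of `{1,…,n}`. -/
def HitsPaths (n t : ℕ) (F : Finset ℕ) : Prop :=
  ∀ i, i + t ≤ n → ∃ a ∈ F, i < a ∧ a ≤ i + t

/-- The 1-based indices of the variables lying in `P`. -/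
noncomputable def varsIn {K : Type*} [Field K] {n : ℕ} (P : Ideal (MvPolynomial (Fin n) K)) :
    Finset ℕ := by
  classical
  exact (Finset.univ.filter fun j : Fin n => X j ∈ P).image fun j => (j : ℕ) + 1

lemma mem_varsIn {K : Type*} [Field K] {n : ℕ} {P : Ideal (MvPolynomial (Fin n) K)} {a : ℕ} :
    a ∈ varsIn P ↔ ∃ j : Fin n, X j ∈ P ∧ (j : ℕ) + 1 = a := by
  simp [varsIn]

lemma varsIn_subset_Icc {K : Type*} [Field K] {n : ℕ} (P : Ideal (MvPolynomial (Fin n) K)) :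
    varsIn P ⊆ Finset.Icc 1 n := by
  intro a ha
  obtain ⟨j, -, rfl⟩ := mem_varsIn.mp ha
  have := j.isLt
  simp only [Finset.mem_Icc]
  omega

lemma pF_le_iff {K : Type*} [Field K] {n : ℕ} {F : Finset ℕ} (hF : F ⊆ Finset.Icc 1 n)
    {P : Ideal (MvPolynomial (Fin n) K)} : pF K n F ≤ P ↔ F ⊆ varsIn P := by
  rw [pF, Ideal.span_le]
  constructor
  · intro h a ha
    have ha' := Finset.mem_Icc.mp (hF ha)
    have hj : ((⟨a - 1, by omega⟩ : Fin n) : ℕ) + 1 = a := by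
      simp only
      omega
    exact mem_varsIn.mpr ⟨_, h ⟨_, by rwa [Set.mem_ofPred_eq, hj], rfl⟩, hj⟩
  · rintro h _ ⟨j, hj, rfl⟩
    obtain ⟨k, hk, hkj⟩ := mem_varsIn.mp (h hj)
    have : k = j := Fin.ext (by omega)
    exact this ▸ hk

lemma varsIn_pF (K : Type*) [Field K] {n : ℕ} {F : Finset ℕ} (hF : F ⊆ Finset.Icc 1 n) :
    varsIn (pF K n F) = F := by
  apply Finset.Subset.antisymm _ ((pF_le_iff hF).mp le_rfl)
  intro a ha
  obtain ⟨j, hj, rfl⟩ := mem_varsIn.mp ha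
  exact (X_mem_pF K).mp hj

lemma pathIdeal_le_iff {K : Type*} [Field K] {n t : ℕ} {P : Ideal (MvPolynomial (Fin n) K)}
    (hP : P.IsPrime) : pathIdeal K n t ≤ P ↔ HitsPaths n t (varsIn P) := by
  rw [pathIdeal, Ideal.span_le, Set.image_subset_iff]
  refine forall₂_congr fun i _ => ?_
  change pathGen K n t i ∈ P ↔ _
  rw [pathGen, hP.prod_mem_iff]
  constructor
  · rintro ⟨j, hj, hX⟩
    simp only [Finset.mem_filter, Finset.mem_univ, true_and] at hj
    exact ⟨j + 1, mem_varsIn.mpr ⟨j, hX, rfl⟩, by omega, by omega⟩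
  · rintro ⟨_, ha, h1, h2⟩
    obtain ⟨j, hX, rfl⟩ := mem_varsIn.mp ha
    refine ⟨j, ?_, hX⟩
    simp only [Finset.mem_filter, Finset.mem_univ, true_and]
    omega

lemma pathIdeal_minimalPrimes_eq_minimal_hitsPaths (K : Type*) [Field K] (n t : ℕ) :
    (pathIdeal K n t).minimalPrimes =
      {P | ∃ F : Finset ℕ, (F ⊆ Finset.Icc 1 n ∧ Minimal (HitsPaths n t) F) ∧ P = pF K n F} := by
  ext P
  constructor
  · rintro ⟨⟨hP, hI⟩, hmin⟩
    have hsub := varsIn_subset_Icc P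
    have hhit := (pathIdeal_le_iff hP).mp hI
    refine ⟨varsIn P, ⟨hsub, hhit, fun G hG hGP => ?_⟩, ?_⟩
    · have hGn : G ⊆ Finset.Icc 1 n := Finset.Subset.trans hGP hsub
      have hle : P ≤ pF K n G :=
        hmin ⟨pF_isPrime K n G, (pathIdeal_le_iff (pF_isPrime K n G)).mpr (by rwa [varsIn_pF K hGn])⟩
          ((pF_le_iff hGn).mpr hGP)
      have := (pF_le_iff hsub).mp (((pF_le_iff hsub).mpr subset_rfl).trans hle)
      rwa [varsIn_pF K hGn] at this
    · have hle := (pF_le_iff (P := P) hsub).mpr subset_rfl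
      refine le_antisymm (hmin ⟨pF_isPrime K n _, ?_⟩ hle) hle
      rwa [pathIdeal_le_iff (pF_isPrime K n _), varsIn_pF K hsub]
  · rintro ⟨F, ⟨hsub, hhit, hmin⟩, rfl⟩
    refine ⟨⟨pF_isPrime K n F, ?_⟩, fun Q ⟨hQ, hIQ⟩ hQF => ?_⟩
    · rwa [pathIdeal_le_iff (pF_isPrime K n _), varsIn_pF K hsub]
    · refine (pF_le_iff hsub).mpr (hmin ((pathIdeal_le_iff hQ).mp hIQ) fun a ha => ?_)
      obtain ⟨j, hj, rfl⟩ := mem_varsIn.mp ha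
      exact (X_mem_pF K).mp (hQF hj)

lemma memC.subset_Icc {n t : ℕ} {F : Finset ℕ} (h : memC n t F) : F ⊆ Finset.Icc 1 n := by
  obtain ⟨r, hr, f, -, rfl, hb, -⟩ := h
  intro a ha
  obtain ⟨j, -, rfl⟩ := Finset.mem_image.mp ha
  exact Finset.mem_Icc.mpr (hb j)

lemma memC.hitsPaths {n t : ℕ} {F : Finset ℕ} (h : memC n t F) : HitsPaths n t F := by
  obtain ⟨r, hr, f, hf, rfl, hb, h1, -, h3, -, -, h6⟩ := h
  intro i hi
  have hex : ∃ k, ∃ hk : k < r, i < f ⟨k, hk⟩ := ⟨r - 1, by omega, by omega⟩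
  classical
  obtain ⟨hk, hik⟩ := Nat.find_spec hex
  have hlt := fun m => Nat.find_min hex (m := m)
  generalize Nat.find hex = k at *
  refine ⟨_, Finset.mem_image_of_mem f (Finset.mem_univ ⟨k, hk⟩), hik, ?_⟩
  rcases k with _ | k
  · omega
  · have hk' : f ⟨k, by omega⟩ ≤ i := by
      by_contra! hc
      exact hlt k (by omega) ⟨_, hc⟩
    have := h3 k hk
    omega

lemma memC.minimal_hitsPaths {n t : ℕ} (htn : t ≤ n) {F : Finset ℕ} (h : memC n t F) :
    Minimal (HitsPaths n t) F := by
  refine ⟨h.hitsPaths, fun G hG hGF => ?_⟩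
  obtain ⟨r, hr, f, hf, rfl, hb, h1, h2, -, h4, h5, -⟩ := h
  intro a ha
  obtain ⟨⟨k, hk⟩, -, rfl⟩ := Finset.mem_image.mp ha
  obtain ⟨i, hin, hlow, hup⟩ : ∃ i, i + t ≤ n ∧ (∀ m (hm : m < r), m < k → f ⟨m, hm⟩ ≤ i) ∧
      (∀ m (hm : m < r), k < m → i + t < f ⟨m, hm⟩) := by
    have mono : ∀ x y (hx : x < r) (hy : y < r), x ≤ y → f ⟨x, hx⟩ ≤ f ⟨y, hy⟩ :=
      fun x y hx hy hxy => hf.monotone hxy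
    rcases k with _ | k
    · refine ⟨0, by omega, by omega, fun m hm h => ?_⟩
      have := mono 1 m (by omega) hm h
      have := h2 (by omega)
      omega
    · refine ⟨f ⟨k, by omega⟩, ?_, fun m hm h => mono _ _ _ _ (by omega), fun m hm h => ?_⟩
      · by_cases hlast : k + 2 < r
        · have := h4 k hlast
          have := hb ⟨k + 2, hlast⟩
          omega
        · have := h5 (by omega)
          have := mono k (r - 2) (by omega) (by omega) (by omega)
          omega
      · have := mono (k + 2) m (by omega) hm h
        have := h4 k (by omega)
        omega
  obtain ⟨b, hbG, hb1, hb2⟩ := hG i hin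
  obtain ⟨⟨m, hm⟩, -, rfl⟩ := Finset.mem_image.mp (hGF hbG)
  obtain rfl : m = k := by
    rcases lt_trichotomy m k with h | h | h
    · have := hlow m hm h
      omega
    · exact h
    · have := hup m hm h
      omega
  exact hbG

lemma exists_private_path {n t : ℕ} {F : Finset ℕ} (h : Minimal (HitsPaths n t) F) {a : ℕ}
    (ha : a ∈ F) : ∃ i, i + t ≤ n ∧ i < a ∧ a ≤ i + t ∧
      ∀ b ∈ F, b ≠ a → b ≤ i ∨ i + t < b := by
  have hnot : ¬ HitsPaths n t (F.erase a) := fun hc =>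
    Finset.notMem_erase a F (h.2 hc (Finset.erase_subset a F) ha)
  simp only [HitsPaths, not_forall, not_exists, not_and, Finset.mem_erase] at hnot
  obtain ⟨i, hi, hnone⟩ := hnot
  have hother : ∀ b ∈ F, b ≠ a → b ≤ i ∨ i + t < b := by
    intro b hb hba
    by_contra! hc
    exact hnone b ⟨hba, hb⟩ hc.1 hc.2
  obtain ⟨b, hb, h1, h2⟩ := h.1 i hi
  by_cases hba : b = a
  · subst hba
    exact ⟨i, hi, h1, h2, hother⟩
  · have := hother b hb hba
    omega

lemma memC_of_minimal_hitsPaths {n t : ℕ} (htn : t ≤ n) {F : Finset ℕ}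
    (hF : F ⊆ Finset.Icc 1 n) (h : Minimal (HitsPaths n t) F) : memC n t F := by
  have hr : 1 ≤ F.card := by
    obtain ⟨a, ha, -⟩ := h.1 0 (by omega)
    exact Finset.card_pos.mpr ⟨a, ha⟩
  obtain ⟨r, hcard⟩ : ∃ r, F.card = r := ⟨_, rfl⟩
  rw [hcard] at hr
  obtain ⟨f, hf, himg⟩ : ∃ f : Fin r → ℕ, StrictMono f ∧ F = Finset.image f Finset.univ :=
    ⟨F.orderEmbOfFin hcard, (F.orderEmbOfFin hcard).strictMono,
      (F.image_orderEmbOfFin_univ hcard).symm⟩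
  have hmem : ∀ j, f j ∈ F := fun j => himg ▸ Finset.mem_image_of_mem f (Finset.mem_univ j)
  have hb : ∀ j, 1 ≤ f j ∧ f j ≤ n := fun j => Finset.mem_Icc.mp (hF (hmem j))
  have lt : ∀ x y (hx : x < r) (hy : y < r), x < y → f ⟨x, hx⟩ < f ⟨y, hy⟩ :=
    fun x y hx hy hxy => hf hxy
  have mono : ∀ x y (hx : x < r) (hy : y < r), x ≤ y → f ⟨x, hx⟩ ≤ f ⟨y, hy⟩ :=
    fun x y hx hy hxy => hf.monotone hxy
  have hits : ∀ i, i + t ≤ n → ∃ k, ∃ hk : k < r, i < f ⟨k, hk⟩ ∧ f ⟨k, hk⟩ ≤ i + t := by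
    intro i hi
    obtain ⟨a, ha, hai⟩ := h.1 i hi
    rw [himg] at ha
    obtain ⟨⟨k, hk⟩, -, rfl⟩ := Finset.mem_image.mp ha
    exact ⟨k, hk, hai⟩
  have priv : ∀ k (hk : k < r), ∃ i, i + t ≤ n ∧
      (∀ m (hm : m < r), m < k → f ⟨m, hm⟩ ≤ i) ∧
      (∀ m (hm : m < r), k < m → i + t < f ⟨m, hm⟩) := by
    intro k hk
    obtain ⟨i, hin, hi1, hi2, hi⟩ := exists_private_path h (hmem ⟨k, hk⟩)
    refine ⟨i, hin, fun m hm hmk => ?_, fun m hm hkm => ?_⟩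
    · have := lt m k hm hk hmk
      have := hi _ (hmem ⟨m, hm⟩) (by omega)
      omega
    · have := lt k m hk hm hkm
      have := hi _ (hmem ⟨m, hm⟩) (by omega)
      omega
  refine ⟨r, hr, f, hf, himg, hb, ?_, fun h1 => ?_, fun j hj => ?_, fun j hj => ?_,
    fun h2 => ?_, ?_⟩
  · obtain ⟨k, hk, -, hk2⟩ := hits 0 (by omega)
    have := mono 0 k hr hk (by omega)
    omega
  · obtain ⟨i, -, -, hup⟩ := priv 0 hr
    have := hup 1 h1 (by omega)
    omega
  · by_contra! hgap
    have := hb ⟨j + 1, hj⟩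
    obtain ⟨k, hk, hk1, hk2⟩ := hits (f ⟨j, by omega⟩) (by omega)
    rcases Nat.lt_or_ge j k with hjk | hjk
    · have := mono (j + 1) k hj hk hjk
      omega
    · have := mono k j hk (by omega) hjk
      omega
  · obtain ⟨i, -, hlow, hup⟩ := priv (j + 1) (by omega)
    have := hlow j (by omega) (by omega)
    have := hup (j + 2) hj (by omega)
    omega
  · obtain ⟨i, hin, hlow, -⟩ := priv (r - 1) (by omega)
    have := hlow (r - 2) (by omega) (by omega)
    omega
  · obtain ⟨k, hk, hk1, -⟩ := hits (n - t) (by omega)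
    have := mono k (r - 1) hk (by omega) (by omega)
    omega

lemma memC_iff_minimal_hitsPaths {n t : ℕ} (htn : t ≤ n) {F : Finset ℕ} :
    memC n t F ↔ F ⊆ Finset.Icc 1 n ∧ Minimal (HitsPaths n t) F :=
  ⟨fun h => ⟨h.subset_Icc, h.minimal_hitsPaths htn⟩,
    fun h => memC_of_minimal_hitsPaths htn h.1 h.2⟩

/-- The set of minimal primes of the `t`-path ideal `I_t(L_n)` is `{p_F : F ∈ C_{n,t}}`. -/
theorem pathIdeal_minimalPrimes (K : Type*) [Field K] (n t : ℕ) (ht : 1 ≤ t) (htn : t ≤ n) :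
    (pathIdeal K n t).minimalPrimes = {P | ∃ F : Finset ℕ, memC n t F ∧ P = pF K n F} := by
  simp_rw [pathIdeal_minimalPrimes_eq_minimal_hitsPaths, memC_iff_minimal_hitsPaths htn]
end

section
/- Let 2 ≤ t ≤ n and write n = (t+1)p + q with 0 ≤ q ≤ t. Then the maximum cardinality of a set belonging to C_{n,t} equals 2p if q < t, and equals 2p+1 if q = t. (Equivalently, the largest degree of a minimal monomial generator of the Alexander dual I_t(L_n)^∨ is 2p if q < t and 2p+1 if q = t.) -/
/-- The extremal sequence `1, t + 1, t + 2, 2 (t + 1), 2 (t + 1) + 1, …`, indexed from zero. -/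
def coverSeq (t j : ℕ) : ℕ := (j + 1) / 2 * (t + 1) + (1 - j % 2)

theorem coverSeq_even (t k : ℕ) : coverSeq t (2 * k) = k * (t + 1) + 1 := by
  simp [coverSeq, show (2 * k + 1) / 2 = k by omega]

theorem coverSeq_odd (t k : ℕ) : coverSeq t (2 * k + 1) = (k + 1) * (t + 1) := by
  simp [coverSeq, show (2 * k + 1 + 1) / 2 = k + 1 by omega, show (2 * k + 1) % 2 = 1 by omega]

theorem coverSeq_add_two (t j : ℕ) : coverSeq t (j + 2) = coverSeq t j + (t + 1) := by
  simp only [coverSeq, show (j + 2 + 1) / 2 = (j + 1) / 2 + 1 by omega, Nat.add_mod_right]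
  ring

theorem coverSeq_succ_le (t j : ℕ) (ht : 1 ≤ t) : coverSeq t (j + 1) ≤ coverSeq t j + t := by
  obtain ⟨k, rfl | rfl⟩ := j.even_or_odd'
  · rw [coverSeq_odd, coverSeq_even]
    linarith
  · rw [show 2 * k + 1 + 1 = 2 * (k + 1) by ring, coverSeq_odd, coverSeq_even]
    omega

theorem coverSeq_strictMono (t : ℕ) (ht : 1 ≤ t) : StrictMono (coverSeq t) := by
  refine strictMono_nat_of_lt_succ fun j => ?_
  have := coverSeq_succ_le t (j + 1) ht
  rw [coverSeq_add_two] at this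
  omega

theorem memC_image_coverSeq {n t r : ℕ} (ht : 1 ≤ t) (hr : 1 ≤ r)
    (hpen : 2 ≤ r → coverSeq t (r - 2) < n - t + 1)
    (hlast : n - t + 1 ≤ coverSeq t (r - 1)) (hle : coverSeq t (r - 1) ≤ n) :
    memC n t (Finset.image (fun j : Fin r => coverSeq t j) Finset.univ) := by
  have hmono := coverSeq_strictMono t ht
  have h0 : coverSeq t 0 = 1 := by simp [coverSeq]
  have h1 : coverSeq t 1 = t + 1 := by simp [coverSeq]
  refine ⟨r, hr, fun j => coverSeq t j, fun i j hij => hmono hij, rfl, fun j => ⟨?_, ?_⟩, ?_,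
    fun _ => ?_, fun j _ => ?_, fun j _ => ?_, hpen, hlast⟩
  · exact h0 ▸ hmono.monotone (Nat.zero_le _)
  · exact (hmono.monotone (by omega)).trans hle
  · exact h0.trans_le ht
  · exact (Nat.lt_succ_self t).trans_eq h1.symm
  · have := coverSeq_succ_le t j ht
    dsimp only
    omega
  · have := coverSeq_add_two t j
    dsimp only
    omega

/-- The elements of a member of `C_{n,t}` dominate the extremal sequence, whence its
cardinality `r` satisfies `⌊r / 2⌋ (t + 1) ≤ n`, and `⌊r / 2⌋ (t + 1) + t ≤ n` for odd `r`. -/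
theorem memC.card_bound {n t : ℕ} {F : Finset ℕ} (htn : t ≤ n) (hF : memC n t F) :
    F.card / 2 * (t + 1) + F.card % 2 * t ≤ n := by
  obtain ⟨r, hr, f, hf, rfl, hbd, -, h1, -, hskip, hpen, -⟩ := hF
  rw [Finset.card_image_of_injective _ hf.injective, Finset.card_univ, Fintype.card_fin]
  have hlow : ∀ k, ∀ h : 2 * k + 1 < r, (k + 1) * (t + 1) ≤ f ⟨2 * k + 1, h⟩ := by
    intro k
    induction k with
    | zero =>
      intro h
      have := h1 h
      simpa using this
    | succ k ih =>
      intro h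
      have := ih (by omega)
      have hs : t < f ⟨2 * (k + 1) + 1, h⟩ - f ⟨2 * k + 1, by omega⟩ := hskip (2 * k + 1) h
      rw [add_mul (k + 1)]
      omega
  obtain ⟨k, rfl | rfl⟩ := r.even_or_odd'
  · obtain ⟨k, rfl⟩ := Nat.exists_eq_succ_of_ne_zero (show k ≠ 0 by omega)
    have := hlow k (by omega)
    have := (hbd ⟨2 * k + 1, by omega⟩).2
    simp only [Nat.mul_mod_right, Nat.succ_eq_add_one, show 2 * (k + 1) / 2 = k + 1 by omega]
    omega
  · simp only [show (2 * k + 1) / 2 = k by omega, show (2 * k + 1) % 2 = 1 by omega, one_mul]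
    rcases k with _ | k
    · simpa using htn
    · have := hlow k (by omega)
      have hp : f ⟨2 * k + 1, by omega⟩ < n - t + 1 := hpen (by omega)
      omega

/-- If `n = (t+1)p + q` with `0 ≤ q ≤ t`, then the maximum cardinality of a member of
`C_{n,t}` (equivalently, the largest degree of a minimal generator of `I_t(L_n)^∨`) is
`2p` if `q < t` and `2p + 1` if `q = t`. -/
theorem max_card_memC (n t p q : ℕ) (ht : 2 ≤ t) (htn : t ≤ n)
    (hn : n = (t + 1) * p + q) (hq : q ≤ t) :
    IsGreatest (Finset.card '' {F | memC n t F}) (if q = t then 2 * p + 1 else 2 * p) := by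
  constructor
  · have key : ∀ r, 1 ≤ r → (2 ≤ r → coverSeq t (r - 2) < n - t + 1) →
        n - t + 1 ≤ coverSeq t (r - 1) → coverSeq t (r - 1) ≤ n →
        r ∈ Finset.card '' {F | memC n t F} := fun r hr hpen hlast hle =>
      ⟨_, memC_image_coverSeq (by omega) hr hpen hlast hle, by
        have hinj : Function.Injective fun j : Fin r => coverSeq t j :=
          (coverSeq_strictMono t (by omega)).injective.comp Fin.val_injective
        rw [Finset.card_image_of_injective _ hinj, Finset.card_univ, Fintype.card_fin]⟩
    split_ifs with hqt
    · have hlast : coverSeq t (2 * p + 1 - 1) = p * (t + 1) + 1 := coverSeq_even t p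
      rw [mul_comm] at hn
      refine key _ (by omega) (fun h => ?_) (by omega) (by omega)
      obtain ⟨k, rfl⟩ := Nat.exists_eq_succ_of_ne_zero (show p ≠ 0 by omega)
      have : coverSeq t (2 * k.succ + 1 - 2) = k.succ * (t + 1) := coverSeq_odd t k
      omega
    · obtain ⟨k, rfl⟩ : ∃ k, p = k + 1 :=
        Nat.exists_eq_succ_of_ne_zero (by rintro rfl; omega)
      have hlast : coverSeq t (2 * (k + 1) - 1) = (k + 1) * (t + 1) := coverSeq_odd t k
      have hpen : coverSeq t (2 * (k + 1) - 2) = k * (t + 1) + 1 := coverSeq_even t k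
      rw [mul_comm] at hn
      rw [add_mul] at hn hlast
      exact key _ (by omega) (fun _ => by omega) (by omega) (by omega)
  · rintro _ ⟨F, hF, rfl⟩
    have hb := memC.card_bound htn hF
    have hk : F.card / 2 ≤ p := by
      by_contra! hlt
      have := Nat.mul_le_mul_right (t + 1) (Nat.succ_le_of_lt hlt)
      rw [Nat.succ_mul, mul_comm p] at this
      omega
    split_ifs with hqt
    · omega
    · by_contra! hlt
      rw [show F.card / 2 = p by omega, show F.card % 2 = 1 by omega, mul_comm p] at hb
      omega
end

section
/- Let K be a field, 2 ≤ t ≤ n, and S = K[x_1,…,x_n], and write n = (t+1)p + q with 0 ≤ q ≤ t. Then the projective dimension of the S-module S/I_t(L_n) equals 2p if q < t, and equals 2p+1 if q = t. -/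
open MvPolynomial CategoryTheory

/-- `M` has projective dimension at most `d`: it admits a projective resolution vanishing
in homological degrees `> d`. -/
def HasProjDimLE {R : Type*} [CommRing R] (M : ModuleCat R) (d : ℕ) : Prop :=
  ∃ P : ProjectiveResolution M, ∀ i > d, Limits.IsZero (P.complex.X i)

/-- `M` has projective dimension exactly `d ≥ 1`: the length of a minimal projective
resolution is exactly `d`. -/
def HasProjDimEq {R : Type*} [CommRing R] (M : ModuleCat R) (d : ℕ) : Prop :=
  HasProjDimLE M d ∧ ∀ e < d, ¬ HasProjDimLE M e

namespace CategoryTheory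

open Limits

universe v u

variable {C : Type u} [Category.{v} C] [Abelian C]

namespace ProjectiveResolution

lemma hasProjectiveDimensionLT {X : C} (P : ProjectiveResolution X) (d : ℕ)
    (hP : ∀ i ≥ d, IsZero (P.complex.X i)) : HasProjectiveDimensionLT X d := by
  let := HasExt.standard C
  rw [hasProjectiveDimensionLT_iff]
  intro i hi Y e
  obtain ⟨f, hf, rfl⟩ := P.extMk_surjective e (i + 1) rfl
  obtain rfl : f = 0 := (hP i hi).eq_of_src _ _
  simp

/-- An exact chain complex of projective objects augmented over `Z` is a projective resolution
of `Z`. -/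
noncomputable def ofExact {Z : C} (K : ChainComplex C ℕ) (hK : ∀ n, Projective (K.X n))
    (ε : K.X 0 ⟶ Z) (hε : Epi ε) (w : K.d 1 0 ≫ ε = 0) (h₀ : (ShortComplex.mk _ _ w).Exact)
    (h : ∀ n, (ShortComplex.mk _ _ (K.d_comp_d (n + 2) (n + 1) n)).Exact) :
    ProjectiveResolution Z where
  complex := K
  projective := hK
  π := (ChainComplex.toSingle₀Equiv _ _).symm ⟨ε, w⟩
  quasiIso := ⟨fun n => by
    cases n with
    | zero =>
      rw [ChainComplex.quasiIsoAt₀_iff, ShortComplex.quasiIso_iff_of_zeros']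
      · refine (ShortComplex.exact_and_epi_g_iff_of_iso ?_).2 ⟨h₀, hε⟩
        exact ShortComplex.isoMk (Iso.refl _) (Iso.refl _) (Iso.refl _)
          (by simp; exact (Category.id_comp _).trans (Category.comp_id _).symm)
          (by simp; exact (Category.id_comp _).trans (Category.comp_id _).symm)
      · exact K.shape _ _ (by simp)
      all_goals rfl
    | succ n =>
      rw [quasiIsoAt_iff_exactAt' _ _ (ChainComplex.exactAt_succ_single_obj _ _),
        HomologicalComplex.exactAt_iff' _ (n + 2) (n + 1) n (by simp) (by simp)]
      exact h n⟩

/-- Splicing a projective resolution of the kernel of an epimorphism `P ⟶ X` from a projective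
object gives a projective resolution of `X`. -/
lemma exists_splice {S : ShortComplex C} (hS : S.ShortExact) (hP : Projective S.X₂)
    (Q : ProjectiveResolution S.X₁) :
    ∃ P : ProjectiveResolution S.X₃, ∀ i, P.complex.X (i + 1) = Q.complex.X i := by
  have := hS.mono_f
  obtain ⟨ε, w, hε, hex⟩ : ∃ (ε : Q.complex.X 0 ⟶ S.X₁) (w : Q.complex.d 1 0 ≫ ε = 0),
      Epi ε ∧ (ShortComplex.mk _ _ w).Exact :=
    ⟨Q.π.f 0, Q.complex_d_comp_π_f_zero, inferInstanceAs (Epi (Q.π.f 0)), Q.exact₀⟩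
  have w' : Q.complex.d 1 0 ≫ ε ≫ S.f = 0 := by rw [← Category.assoc, w, zero_comp]
  have w'' : (ε ≫ S.f) ≫ S.g = 0 := by simp
  let K := Q.complex.augment (ε ≫ S.f) w'
  refine ⟨ofExact (Z := S.X₃) K ?_ S.g hS.epi_g w'' ?_ ?_, fun i => rfl⟩
  · rintro (_ | n)
    · exact hP
    · exact Q.projective n
  · let α : ShortComplex.mk (ε ≫ S.f) S.g w'' ⟶ S :=
      { τ₁ := ε, τ₂ := 𝟙 _, τ₃ := 𝟙 _ }
    exact (ShortComplex.exact_iff_of_epi_of_isIso_of_mono α).2 hS.exact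
  · rintro (_ | n)
    · let α : ShortComplex.mk _ _ w ⟶ ShortComplex.mk _ _ w' :=
        { τ₁ := 𝟙 _, τ₂ := 𝟙 _, τ₃ := S.f }
      exact (ShortComplex.exact_iff_of_epi_of_isIso_of_mono α).1 hex
    · exact Q.exact_succ n

end ProjectiveResolution

lemma HasProjectiveDimensionLE.exists_projectiveResolution [EnoughProjectives C] (d : ℕ) (X : C)
    [HasProjectiveDimensionLE X d] :
    ∃ P : ProjectiveResolution X, ∀ i > d, IsZero (P.complex.X i) := by
  induction d generalizing X with
  | zero =>
    have : Projective X := (projective_iff_hasProjectiveDimensionLE_zero X).2 inferInstance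
    refine ⟨.self X, fun i hi => ?_⟩
    exact HomologicalComplex.isZero_single_obj_X _ _ _ _ hi.ne'
  | succ d ih =>
    obtain ⟨Q⟩ := EnoughProjectives.presentation X
    have hS : (ShortComplex.mk (kernel.ι Q.f) Q.f (kernel.condition _)).ShortExact :=
      { exact := ShortComplex.exact_kernel Q.f }
    have := (hS.hasProjectiveDimensionLT_X₃_iff d Q.projective).1 ‹_›
    obtain ⟨R, hR⟩ := ih (kernel Q.f)
    obtain ⟨P, hP⟩ := R.exists_splice hS Q.projective
    refine ⟨P, fun i hi => ?_⟩
    obtain ⟨i, rfl⟩ := Nat.exists_eq_add_of_lt hi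
    rw [hP]
    exact hR _ (by lia)

end CategoryTheory

lemma hasProjDimLE_iff.{u} {R : Type u} [CommRing R] (M : ModuleCat.{u} R) (d : ℕ) :
    HasProjDimLE M d ↔ HasProjectiveDimensionLE M d :=
  ⟨fun ⟨P, hP⟩ => P.hasProjectiveDimensionLT (d + 1) fun i hi => hP i hi,
    fun _ => HasProjectiveDimensionLE.exists_projectiveResolution d M⟩

lemma hasProjectiveDimensionLT_quotient_sup {R : Type*} [CommRing R] {I J : Ideal R} {w : R}
    (hJ : ∀ f, f ∈ J ↔ w * f ∈ I) {k : ℕ}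
    (hJk : HasProjectiveDimensionLT (ModuleCat.of R (R ⧸ J)) k)
    (hIk : HasProjectiveDimensionLT (ModuleCat.of R (R ⧸ I)) (k + 1)) :
    HasProjectiveDimensionLT (ModuleCat.of R (R ⧸ (I ⊔ Ideal.span {w}))) (k + 1) := by
  let f : (R ⧸ J) →ₗ[R] R ⧸ I := Submodule.mapQ J I (LinearMap.mulLeft R w) fun x hx => (hJ x).1 hx
  let g : (R ⧸ I) →ₗ[R] R ⧸ (I ⊔ Ideal.span {w}) := Submodule.factor le_sup_left
  have hgf : g ∘ₗ f = 0 := by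
    refine Submodule.linearMap_qext _ (LinearMap.ext_ring ?_)
    change Submodule.Quotient.mk (w * 1) = 0
    rw [mul_one]
    exact (Submodule.Quotient.mk_eq_zero _).2
      (Ideal.mem_sup_right (Ideal.mem_span_singleton_self w))
  let S : ShortComplex (ModuleCat R) :=
    ShortComplex.mk (ModuleCat.ofHom f) (ModuleCat.ofHom g) (by ext : 1; exact hgf)
  have hS : S.ShortExact := by
    refine ModuleCat.shortComplex_shortExact S ?_ ?_ ?_
    · refine LinearMap.exact_iff.2 (le_antisymm ?_ ?_)
      · intro x hx
        obtain ⟨x, rfl⟩ := Submodule.Quotient.mk_surjective _ x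
        have hx' : x ∈ I ⊔ Ideal.span {w} := (Submodule.Quotient.mk_eq_zero _).1 hx
        obtain ⟨a, ha, b, hb, rfl⟩ := Submodule.mem_sup.1 hx'
        obtain ⟨c, rfl⟩ := Ideal.mem_span_singleton'.1 hb
        refine ⟨Submodule.Quotient.mk c, (Submodule.Quotient.eq _).2 ?_⟩
        simpa [mul_comm] using ha
      · rintro _ ⟨x, rfl⟩
        exact LinearMap.congr_fun hgf x
    · refine (injective_iff_map_eq_zero f).2 fun x hx => ?_
      obtain ⟨x, rfl⟩ := Submodule.Quotient.mk_surjective _ x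
      exact (Submodule.Quotient.mk_eq_zero _).2 ((hJ x).2 ((Submodule.Quotient.mk_eq_zero _).1 hx))
    · exact Submodule.factor_surjective le_sup_left
  exact hS.hasProjectiveDimensionLT_X₃ k hJk hIk

lemma not_hasProjectiveDimensionLT_quotient.{u} {R : Type u} [CommRing R] [IsNoetherianRing R]
    (I P : Ideal R) [P.IsPrime] (rs : List R) (hrs : RingTheory.Sequence.IsWeaklyRegular R rs)
    (hP : ∀ r ∈ rs, r ∈ P) (hI : I ≤ Ideal.ofList rs) (hw : ∀ r ∈ rs, ∃ w ∉ P, r * w ∈ I) :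
    ¬ HasProjectiveDimensionLT (ModuleCat.of R (R ⧸ I)) rs.length := by
  let A := Localization.AtPrime P
  have hreg := hrs.isRegular_of_isLocalization_of_mem A P hP
  have hmap : I.map (algebraMap R A) = Ideal.ofList (rs.map (algebraMap R A)) := by
    rw [← Ideal.map_ofList]
    refine le_antisymm (Ideal.map_mono hI) ?_
    rw [Ideal.map_le_iff_le_comap, Ideal.ofList, Ideal.span_le]
    intro r hr
    obtain ⟨w, hw, hrw⟩ := hw r hr
    have hu : IsUnit (algebraMap R A w) := IsLocalization.map_units A (⟨w, hw⟩ : P.primeCompl)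
    have := Ideal.mem_map_of_mem (algebraMap R A) hrw
    rw [map_mul] at this
    exact (Ideal.mul_unit_mem_iff_mem _ hu).1 this
  have hlen := ModuleCat.projectiveDimension_quotient_eq_length.{u, u} _ hreg
  rw [List.length_map] at hlen
  intro h
  rw [← projectiveDimension_lt_iff] at h
  refine absurd (hlen ▸ lt_of_eq_of_lt ?_ (lt_of_le_of_lt
    (ModuleCat.projectiveDimension_le_projectiveDimension_of_isLocalizedModule P.primeCompl _) h))
    (lt_irrefl _)
  refine ModuleCat.projectiveDimension_eq_of_linearEquiv ?_
  have e₁ : (A ⧸ I.map (algebraMap R A)) ≃ₗ[A] (A ⧸ Ideal.ofList (rs.map (algebraMap R A))) :=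
    Submodule.quotEquivOfEq _ _ hmap
  have e₂ : (A ⧸ I.map (algebraMap R A)) ≃ₗ[A]
      (A ⧸ Submodule.localized' A P.primeCompl (Algebra.linearMap R A) I) :=
    Submodule.quotEquivOfEq _ _ (Ideal.localized'_eq_map A P.primeCompl I).symm
  have e₃ := IsLocalizedModule.linearEquiv P.primeCompl
    (Submodule.toLocalizedQuotient' A P.primeCompl (Algebra.linearMap R A) I)
    (LocalizedModule.mkLinearMap P.primeCompl (R ⧸ I))
  have e₄ := e₃.extendScalarsOfIsLocalization P.primeCompl A
  exact (Shrink.linearEquiv A _).trans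
    (e₁.symm.trans (e₂.trans (e₄.trans (Shrink.linearEquiv A _).symm)))

namespace MvPolynomial

lemma monomial_mul_mem_span_iff {σ R : Type*} [CommSemiring R] (s : σ →₀ ℕ) (T : Set (σ →₀ ℕ))
    (f : MvPolynomial σ R) :
    monomial s 1 * f ∈ Ideal.span ((fun τ => monomial τ (1 : R)) '' T) ↔
      ∀ ξ ∈ f.support, ∃ τ ∈ T, τ ≤ s + ξ := by
  rw [mem_ideal_span_monomial_image]
  constructor
  · intro h ξ hξ
    refine h _ ?_
    rwa [mem_support_iff, coeff_monomial_mul, one_mul, ← mem_support_iff]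
  · intro h ξ hξ
    rw [mem_support_iff, coeff_monomial_mul'] at hξ
    obtain ⟨hs, hξ⟩ : s ≤ ξ ∧ coeff (ξ - s) f ≠ 0 := by simpa using hξ
    simpa [add_tsub_cancel_of_le hs] using h _ (mem_support_iff.2 hξ)

/-- A list of distinct variables is a weakly regular sequence. -/
lemma isWeaklyRegular_map_X {σ R : Type*} [CommRing R] (l : List σ) (hl : l.Nodup) :
    RingTheory.Sequence.IsWeaklyRegular (MvPolynomial σ R)
      (l.map (X : σ → MvPolynomial σ R)) := by
  rw [RingTheory.Sequence.isWeaklyRegular_iff]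
  intro i hi
  have hi' : i < l.length := by simpa using hi
  have hspan : (Ideal.ofList ((l.map (X : σ → MvPolynomial σ R)).take i) • ⊤ :
      Submodule (MvPolynomial σ R) (MvPolynomial σ R)) =
      Ideal.span ((X : σ → MvPolynomial σ R) '' {j | j ∈ l.take i}) := by
    rw [smul_eq_mul, Ideal.mul_top, Ideal.ofList, ← List.map_take]
    congr 1
    ext f
    exact List.mem_map
  have hnot : l[i] ∉ l.take i := by
    intro h
    obtain ⟨k, hk, hkl⟩ := List.mem_take_iff_getElem.1 h
    have := (hl.getElem_inj_iff).1 hkl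
    lia
  rw [hspan, isSMulRegular_iff_right_eq_zero_of_smul]
  intro f hf
  obtain ⟨f, rfl⟩ := Submodule.Quotient.mk_surjective _ f
  rw [← Submodule.Quotient.mk_smul, Submodule.Quotient.mk_eq_zero, List.getElem_map, smul_eq_mul,
    mem_ideal_span_X_image] at hf
  rw [Submodule.Quotient.mk_eq_zero, mem_ideal_span_X_image]
  intro m hm
  have hm' : Finsupp.single l[i] 1 + m ∈ ((X l[i] : MvPolynomial σ R) * f).support := by
    rw [mem_support_iff, coeff_X_mul]
    exact mem_support_iff.1 hm
  obtain ⟨j, hj, hjm⟩ := hf _ hm'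
  have hne : l[i] ≠ j := by rintro rfl; exact hnot hj
  exact ⟨j, hj, by simpa [Finsupp.single_apply, hne] using hjm⟩

end MvPolynomial

section PathIdeal

variable (K : Type*) [Field K] (n t : ℕ)

/-- The exponent vector of the generator `pathGen K n t i`. -/
noncomputable def pathExp (i : ℕ) : Fin n →₀ ℕ :=
  Finsupp.equivFunOnFinite.symm fun j => if i ≤ (j : ℕ) ∧ (j : ℕ) < i + t then 1 else 0

lemma pathExp_apply (i : ℕ) (j : Fin n) :
    pathExp n t i j = if i ≤ (j : ℕ) ∧ (j : ℕ) < i + t then 1 else 0 := rfl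

lemma pathGen_eq_monomial (i : ℕ) : pathGen K n t i = monomial (pathExp n t i) 1 := by
  rw [monomial_eq, pathGen, Finset.prod_filter, Finsupp.prod_fintype _ _ (by simp)]
  simp [pathExp_apply, pow_ite]

lemma pathExp_le_iff (i : ℕ) (ξ : Fin n →₀ ℕ) :
    pathExp n t i ≤ ξ ↔ ∀ j : Fin n, i ≤ (j : ℕ) → (j : ℕ) < i + t → ξ j ≠ 0 := by
  refine forall_congr' fun j => ?_
  rw [pathExp_apply]
  split_ifs <;> grind

/-- The ideal generated by the path generators supported on the first `m` variables. -/
noncomputable def pathIdealPrefix (m : ℕ) : Ideal (MvPolynomial (Fin n) K) :=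
  Ideal.span (pathGen K n t '' {i | i + t ≤ m})

variable {K n t}

lemma pathIdealPrefix_eq (m : ℕ) : pathIdealPrefix K n t m =
    Ideal.span ((fun τ => monomial τ (1 : K)) '' (pathExp n t '' {i | i + t ≤ m})) := by
  rw [pathIdealPrefix, Set.image_image]
  simp_rw [← pathGen_eq_monomial]

lemma pathIdealPrefix_sup_X_eq (m : ℕ) (k : Fin n) :
    pathIdealPrefix K n t m ⊔ Ideal.span {X k} = Ideal.span ((fun τ => monomial τ (1 : K)) ''
      (insert (Finsupp.single k 1) (pathExp n t '' {i | i + t ≤ m}))) := by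
  rw [pathIdealPrefix_eq, Set.image_insert_eq, Ideal.span_insert, sup_comm]
  rfl

lemma pathIdealPrefix_sup_pathGen (m : ℕ) :
    pathIdealPrefix K n t (m + t) ⊔ Ideal.span {pathGen K n t (m + 1)} =
      pathIdealPrefix K n t (m + 1 + t) := by
  rw [pathIdealPrefix, pathIdealPrefix, sup_comm, ← Ideal.span_insert, ← Set.image_insert_eq]
  congr 2
  ext i
  simp only [Set.mem_insert_iff, Set.mem_ofPred_eq]
  lia

lemma mem_pathIdealPrefix_iff_X_mul_mem (m : ℕ) (k : Fin n) (hk : m ≤ k)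
    (f : MvPolynomial (Fin n) K) :
    f ∈ pathIdealPrefix K n t m ↔ X k * f ∈ pathIdealPrefix K n t m := by
  rw [pathIdealPrefix_eq, X, monomial_mul_mem_span_iff, mem_ideal_span_monomial_image]
  simp only [Set.exists_mem_image, pathExp_le_iff]
  refine forall₂_congr fun ξ _ => exists_congr fun i => and_congr_right fun hi => ?_
  refine forall₃_congr fun j _ hj => ?_
  have : k ≠ j := by rintro rfl; simp at hi; lia
  simp [this]

lemma mem_pathIdealPrefix_sup_X_iff (m : ℕ) (k : Fin n) (hk : (k : ℕ) = m)
    (f : MvPolynomial (Fin n) K) :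
    f ∈ pathIdealPrefix K n t m ⊔ Ideal.span {X k} ↔
      pathGen K n t (m + 1) * f ∈ pathIdealPrefix K n t (m + t) := by
  rw [pathIdealPrefix_sup_X_eq, pathIdealPrefix_eq, pathGen_eq_monomial, monomial_mul_mem_span_iff,
    mem_ideal_span_monomial_image]
  refine forall₂_congr fun ξ _ => ?_
  simp only [Set.exists_mem_image, Set.mem_insert_iff, exists_eq_or_imp, pathExp_le_iff,
    Finsupp.single_le_iff, Set.mem_ofPred_eq, Finsupp.add_apply, pathExp_apply]
  constructor
  · rintro (h | ⟨i, hi, h⟩)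
    · refine ⟨m, le_rfl, fun j h₁ h₂ => ?_⟩
      rcases h₁.eq_or_lt with h₁ | h₁
      · obtain rfl : k = j := Fin.ext (hk.trans h₁)
        lia
      · rw [if_pos (by lia)]
        lia
    · exact ⟨i, by lia, fun j h₁ h₂ => by have := h j h₁ h₂; lia⟩
  · rintro ⟨i, hi, h⟩
    by_cases him : i + t ≤ m
    · refine Or.inr ⟨i, him, fun j h₁ h₂ => ?_⟩
      have := h j h₁ h₂
      rw [if_neg (by lia)] at this
      lia
    · have := h k (by lia) (by lia)
      rw [if_neg (by lia)] at this
      left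
      lia

lemma pathIdealPrefix_eq_bot (m : ℕ) (hm : m < t) : pathIdealPrefix K n t m = ⊥ := by
  have : {i | i + t ≤ m} = ∅ := by ext; simp; lia
  simp [pathIdealPrefix, this]

end PathIdeal

lemma hasProjectiveDimensionLT_pathIdealPrefix (K : Type*) [Field K] (n t : ℕ) (ht : 0 < t)
    (m : ℕ) (hm : m ≤ n) :
    HasProjectiveDimensionLT
      (ModuleCat.of (MvPolynomial (Fin n) K) (MvPolynomial (Fin n) K ⧸ pathIdealPrefix K n t m))
      (2 * (m / (t + 1)) + (if m % (t + 1) = t then 1 else 0) + 1) := by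
  induction m using Nat.strong_induction_on with
  | _ m ih =>
  have hbot (r : ℕ) (hr : r < t) : HasProjectiveDimensionLT
      (ModuleCat.of (MvPolynomial (Fin n) K) (MvPolynomial (Fin n) K ⧸ pathIdealPrefix K n t r))
      1 := by
    have e := Submodule.quotEquivOfEqBot _ (pathIdealPrefix_eq_bot (K := K) (n := n) r hr)
    have := Module.Projective.of_equiv e.symm
    infer_instance
  rcases lt_trichotomy m t with hmt | rfl | hmt
  · have := hbot m hmt
    exact hasProjectiveDimensionLT_of_ge _ 1 _ (by lia)
  · obtain ⟨s, rfl⟩ : ∃ s, m = s + 1 := ⟨m - 1, by lia⟩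
    have hs : pathIdealPrefix K n (s + 1) s = ⊥ := pathIdealPrefix_eq_bot s (by lia)
    have hgen : pathIdealPrefix K n (s + 1) (s + 1) =
        pathIdealPrefix K n (s + 1) s ⊔ Ideal.span {pathGen K n (s + 1) 0} := by
      rw [hs, bot_sup_eq, pathIdealPrefix, ← Set.image_singleton]
      congr 2
      ext i
      simp
    have hne : pathGen K n (s + 1) 0 ≠ 0 := by
      rw [pathGen_eq_monomial]
      simp
    have h := hasProjectiveDimensionLT_quotient_sup (w := pathGen K n (s + 1) 0)
      (I := pathIdealPrefix K n (s + 1) s) (J := pathIdealPrefix K n (s + 1) s) (k := 1)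
      (fun f => by simp [hs, hne]) (hbot s (by lia))
      (have := hbot s (by lia); hasProjectiveDimensionLT_of_ge _ 1 _ (by lia))
    rw [hgen]
    exact hasProjectiveDimensionLT_of_ge _ 2 _ (by simp)
  · obtain ⟨r, rfl⟩ : ∃ r, m = r + 1 + t := ⟨m - 1 - t, by lia⟩
    have hdiv : (r + 1 + t) / (t + 1) = r / (t + 1) + 1 := by
      rw [← Nat.add_div_right r (Nat.succ_pos t)]; congr 1; lia
    have hmod : (r + 1 + t) % (t + 1) = r % (t + 1) := by
      rw [← Nat.add_mod_right r (t + 1)]; congr 1; lia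
    have hr := ih r (by lia) (by lia)
    have hp := ih (r + t) (by lia) (by lia)
    have hX := hasProjectiveDimensionLT_quotient_sup
      (mem_pathIdealPrefix_iff_X_mul_mem r ⟨r, by lia⟩ le_rfl) hr
      (hasProjectiveDimensionLT_of_ge _ _ _ (Nat.le_succ _))
    rw [← pathIdealPrefix_sup_pathGen, hdiv, hmod]
    refine hasProjectiveDimensionLT_quotient_sup
      (mem_pathIdealPrefix_sup_X_iff r ⟨r, by lia⟩ rfl) ?_ ?_
    · convert hX using 1
      ring
    · refine @hasProjectiveDimensionLT_of_ge _ _ _ _ _ _ ?_ hp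
      have h₁ : (r + t) / (t + 1) ≤ r / (t + 1) + 1 := by
        rw [← hdiv]; exact Nat.div_le_div_right (by lia)
      by_cases h : (r + t) % (t + 1) = t
      · have hr0 : (r + t) / (t + 1) ≤ r / (t + 1) := by
          have e₁ := Nat.div_add_mod (r + t) (t + 1)
          rw [h] at e₁
          have e₂ : r = (t + 1) * ((r + t) / (t + 1)) := by lia
          rw [Nat.le_div_iff_mul_le (by lia), mul_comm]
          exact e₂.ge
        rw [if_pos h]
        lia
      · rw [if_neg h]
        lia

lemma not_hasProjectiveDimensionLT_pathIdeal (K : Type*) [Field K] (n t p q : ℕ) (ht : 0 < t)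
    (hn : n = (t + 1) * p + q) (hq : q ≤ t) :
    ¬ HasProjectiveDimensionLT
      (ModuleCat.of (MvPolynomial (Fin n) K) (MvPolynomial (Fin n) K ⧸ pathIdeal K n t))
      (if q = t then 2 * p + 1 else 2 * p) := by
  set d := if q = t then 2 * p + 1 else 2 * p with hd
  have hlt (k : ℕ) (hk : k < d) : k / 2 < p ∨ (k / 2 = p ∧ k % 2 = 0 ∧ q = t) := by grind
  have hmul (b : ℕ) (hb : b < p) : (t + 1) * b + (t + 1) ≤ (t + 1) * p :=
    Nat.mul_le_mul_left (t + 1) hb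
  have hk_lt (k : ℕ) (hk : k < d) : (t + 1) * (k / 2) + t * (k % 2) < n := by
    rcases hlt k hk with h | ⟨h, h', rfl⟩
    · have := hmul _ h
      rcases Nat.mod_two_eq_zero_or_one k with h' | h' <;> rw [h'] <;> lia
    · rw [h, h']; lia
  let a : Fin d → Fin n := fun k => ⟨(t + 1) * (k / 2) + t * (k % 2), hk_lt k k.2⟩
  have hdiv (b c : ℕ) (hc : c ≤ t) : ((t + 1) * b + c) / (t + 1) = b ∧
      ((t + 1) * b + c) % (t + 1) = c := by
    rw [Nat.mul_add_div (by lia), Nat.mul_add_mod, Nat.div_eq_of_lt (by lia),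
      Nat.mod_eq_of_lt (by lia)]
    exact ⟨rfl, rfl⟩
  have ha : Function.Injective a := by
    intro k k' h
    have h' : (t + 1) * (k / 2) + t * (k % 2) = (t + 1) * (k' / 2) + t * (k' % 2) :=
      congrArg Fin.val h
    have hc (k : ℕ) : t * (k % 2) ≤ t := by
      rcases Nat.mod_two_eq_zero_or_one k with h | h <;> simp [h]
    obtain ⟨e₁, e₂⟩ := hdiv (k / 2) _ (hc k)
    obtain ⟨e₃, e₄⟩ := hdiv (k' / 2) _ (hc k')
    rw [h'] at e₁ e₂
    have h₁ : (k : ℕ) / 2 = k' / 2 := e₁.symm.trans e₃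
    have h₂ : (k : ℕ) % 2 = k' % 2 := Nat.eq_of_mul_eq_mul_left ht (e₂.symm.trans e₄)
    lia
  let P : Ideal (MvPolynomial (Fin n) K) := RingHom.ker
    (aeval (fun j : Fin n => if j ∈ Set.range a then 0 else X j) :
      MvPolynomial (Fin n) K →ₐ[K] MvPolynomial (Fin n) K)
  have hPmem (j : Fin n) : X j ∈ P ↔ j ∈ Set.range a := by
    simp only [P, RingHom.mem_ker, aeval_X]
    split_ifs with h <;> simp [h, X_ne_zero]
  have : P.IsPrime := RingHom.ker_isPrime _
  have hlen : ((List.ofFn a).map (X : Fin n → MvPolynomial (Fin n) K)).length = d := by simp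
  rw [← hlen]
  refine not_hasProjectiveDimensionLT_quotient _ P _
    (isWeaklyRegular_map_X _ (List.nodup_ofFn.2 ha)) ?_ ?_ ?_
  · intro r hr
    obtain ⟨j, hj, rfl⟩ := List.mem_map.1 hr
    exact (hPmem j).2 (List.mem_ofFn.1 hj)
  · rw [pathIdeal, Ideal.span_le]
    rintro _ ⟨i, hi, rfl⟩
    obtain ⟨k, hk₁, hk₂⟩ : ∃ k : Fin d, i ≤ (a k : ℕ) ∧ (a k : ℕ) < i + t := by
      have hi : i + t ≤ n := hi
      have hi' := Nat.div_add_mod i (t + 1)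
      have hr := Nat.mod_lt i (Nat.succ_pos t)
      set b := i / (t + 1)
      have hb : b ≤ p := by
        by_contra! h
        have := Nat.mul_le_mul_left (t + 1) h
        lia
      rcases Nat.eq_zero_or_pos (i % (t + 1)) with h | h
      · have hbd : 2 * b < d := by
          rcases hb.eq_or_lt with rfl | hb
          · rw [hd, if_pos (by lia)]; lia
          · grind
        refine ⟨⟨2 * b, hbd⟩, ?_⟩
        simp only [a, Nat.mul_div_right b two_pos, Nat.mul_mod_right]
        lia
      · have hbp : b < p := by
          refine hb.lt_of_ne ?_
          rintro rfl
          lia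
        refine ⟨⟨2 * b + 1, by grind⟩, ?_⟩
        have h₁ : (2 * b + 1) / 2 = b := by lia
        have h₂ : (2 * b + 1) % 2 = 1 := by lia
        simp only [a, h₁, h₂]
        lia
    refine Ideal.mem_of_dvd _ (Finset.dvd_prod_of_mem _ (a := a k) (by simp [hk₁, hk₂]))
      (Ideal.subset_span ?_)
    exact List.mem_map_of_mem (List.mem_ofFn.2 ⟨k, rfl⟩)
  · intro r hr
    obtain ⟨_, hj, rfl⟩ := List.mem_map.1 hr
    obtain ⟨k, rfl⟩ := List.mem_ofFn.1 hj
    obtain ⟨i, hi, hk₁, hk₂, hik⟩ : ∃ i, i + t ≤ n ∧ i ≤ (a k : ℕ) ∧ (a k : ℕ) < i + t ∧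
        ∀ k' : Fin d, i ≤ (a k' : ℕ) → (a k' : ℕ) < i + t → a k' = a k := by
      have hk := hlt k k.2
      have key (k' : Fin d) (h : (k' : ℕ) / 2 = k / 2) (h' : (k' : ℕ) % 2 = k % 2) : a k' = a k :=
        congrArg a (Fin.ext (by lia))
      have hblock (k' : Fin d) (h₁ : (t + 1) * (k / 2) ≤ (a k' : ℕ))
          (h₂ : (a k' : ℕ) < (t + 1) * (k / 2) + (t + 1)) : (k' : ℕ) / 2 = k / 2 := by
        simp only [a] at h₁ h₂
        rcases lt_trichotomy ((k' : ℕ) / 2) (k / 2) with h | h | h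
        · have := Nat.mul_le_mul_left (t + 1) h
          rcases Nat.mod_two_eq_zero_or_one k' with h' | h' <;> rw [h'] at h₁ <;> lia
        · exact h
        · have := Nat.mul_le_mul_left (t + 1) h
          exact absurd ((this.trans (Nat.le_add_right _ _)).trans_lt h₂) (lt_irrefl _)
      rcases Nat.mod_two_eq_zero_or_one k with hk' | hk'
      · refine ⟨(t + 1) * (k / 2), ?_, ?_, ?_, fun k' h₁ h₂ => ?_⟩
        · rcases hk with hk | ⟨hk, -, rfl⟩
          · have := hmul _ hk
            lia
          · rw [hk, hn]
        · simp [a]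
        · simpa [a, hk'] using ht
        · have hb := hblock k' (by lia) (by lia)
          refine key k' hb ?_
          simp only [a, hb] at h₁ h₂
          rcases Nat.mod_two_eq_zero_or_one k' with h' | h' <;> rw [h'] at h₂ <;> lia
      · refine ⟨(t + 1) * (k / 2) + 1, ?_, ?_, ?_, fun k' h₁ h₂ => ?_⟩
        · have := hmul (k / 2) (by lia)
          lia
        · simp only [a, hk']; lia
        · simp only [a, hk']; lia
        · have hb := hblock k' (by lia) (by lia)
          refine key k' hb ?_
          simp only [a, hb] at h₁ h₂
          rcases Nat.mod_two_eq_zero_or_one k' with h' | h' <;> rw [h'] at h₁ <;> lia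
    refine ⟨∏ j ∈ (Finset.univ.filter
      (fun j : Fin n => i ≤ (j : ℕ) ∧ (j : ℕ) < i + t)).erase (a k), X j, ?_, ?_⟩
    · intro hmem
      obtain ⟨j, hj, hjP⟩ := (Ideal.IsPrime.prod_mem_iff).1 hmem
      obtain ⟨k', rfl⟩ := (hPmem j).1 hjP
      simp only [Finset.mem_erase, Finset.mem_filter] at hj
      exact hj.1 (hik k' hj.2.2.1 hj.2.2.2)
    · rw [Finset.mul_prod_erase _ _ (by simp [hk₁, hk₂])]
      exact Ideal.subset_span ⟨i, hi, rfl⟩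

/-- If `n = (t+1)p + q` with `0 ≤ q ≤ t`, then the projective dimension of `S/I_t(L_n)`
is `2p` when `q < t` and `2p + 1` when `q = t`. -/
theorem projDim_pathIdeal (K : Type*) [Field K] (n t p q : ℕ) (ht : 2 ≤ t) (htn : t ≤ n)
    (hn : n = (t + 1) * p + q) (hq : q ≤ t) :
    HasProjDimEq
      (ModuleCat.of (MvPolynomial (Fin n) K)
        (MvPolynomial (Fin n) K ⧸ pathIdeal K n t))
      (if q = t then 2 * p + 1 else 2 * p) := by
  constructor
  · rw [hasProjDimLE_iff]
    have h := hasProjectiveDimensionLT_pathIdealPrefix K n t (by lia) n le_rfl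
    have hdiv : n / (t + 1) = p := by
      rw [hn, Nat.mul_add_div (by lia), Nat.div_eq_of_lt (by lia), add_zero]
    have hmod : n % (t + 1) = q := by
      rw [hn, Nat.mul_add_mod, Nat.mod_eq_of_lt (by lia)]
    rw [hdiv, hmod] at h
    have e : (if q = t then 2 * p + 1 else 2 * p) = 2 * p + (if q = t then 1 else 0) := by
      split_ifs <;> rfl
    rw [e]
    exact h
  · intro e he h
    rw [hasProjDimLE_iff] at h
    exact not_hasProjectiveDimensionLT_pathIdeal K n t p q (by lia) hn hq
      (hasProjectiveDimensionLT_of_ge _ _ _ he)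
end

section
/- Let K be a field, 2 ≤ t ≤ n, and S = K[x_1,…,x_n], and write n = a t + b with a ≥ 1 and 0 ≤ b < t. Let 1 ≤ i_1 < i_2 < ⋯ < i_a ≤ n and let p = (x_{i_1}, …, x_{i_a}). Then p is a minimal prime of I_t(L_n) (equivalently, an associated prime of S/I_t(L_n)) if and only if: (1) (j−1)t + b + 1 ≤ i_j ≤ j t for all 1 ≤ j ≤ a, and (2) i_{j+1} − i_j ≤ t for all 1 ≤ j ≤ a−1. -/
open MvPolynomial

theorem MvPolynomial.X_mem_span_X_image_iff {σ R : Type*} [CommSemiring R] [Nontrivial R]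
    {s : Set σ} {i : σ} :
    (X i : MvPolynomial σ R) ∈ Ideal.span ((fun j => X j) '' s) ↔ i ∈ s := by
  classical
  refine ⟨fun h => ?_, fun h => Ideal.subset_span ⟨i, h, rfl⟩⟩
  obtain ⟨j, hj, hij⟩ := mem_ideal_span_X_image.1 h (Finsupp.single i 1) (by simp [support_X])
  rw [Finsupp.single_apply] at hij
  split_ifs at hij with h'
  · exact h' ▸ hj
  · exact absurd rfl hij

theorem MvPolynomial.isPrime_span_X_image {σ R : Type*} [CommRing R] [IsDomain R] (s : Set σ) :
    (Ideal.span ((fun j => X j) '' s) : Ideal (MvPolynomial σ R)).IsPrime := by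
  classical
  set I : Ideal (MvPolynomial σ R) := Ideal.span ((fun j => X j) '' s) with hI
  let φ : MvPolynomial σ R →ₐ[R] MvPolynomial σ R := aeval fun i => if i ∈ s then 0 else X i
  have hφ : (Ideal.Quotient.mkₐ R I).comp φ = Ideal.Quotient.mkₐ R I := by
    refine algHom_ext fun i => ?_
    by_cases hi : i ∈ s
    · have h : Ideal.Quotient.mk I (X i) = 0 :=
        Ideal.Quotient.eq_zero_iff_mem.2 (Ideal.subset_span ⟨i, hi, rfl⟩)
      simp [φ, hi, h]
    · simp [φ, hi]
  have hker : I = RingHom.ker φ := by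
    refine le_antisymm (Ideal.span_le.2 ?_) fun x hx => ?_
    · rintro _ ⟨i, hi, rfl⟩
      simp [φ, hi, RingHom.mem_ker]
    · have h := DFunLike.congr_fun hφ x
      rw [AlgHom.comp_apply, RingHom.mem_ker.1 hx, map_zero] at h
      exact Ideal.Quotient.eq_zero_iff_mem.1 h.symm
  rw [hker]
  exact RingHom.ker_isPrime _

theorem pathIdeal_le_iff_of_isPrime {K : Type*} [Field K] {n t : ℕ}
    {P : Ideal (MvPolynomial (Fin n) K)} (hP : P.IsPrime) :
    pathIdeal K n t ≤ P ↔
      ∀ i, i + t ≤ n → ∃ j : Fin n, (i ≤ (j : ℕ) ∧ (j : ℕ) < i + t) ∧ X j ∈ P := by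
  simp only [pathIdeal, Ideal.span_le, Set.image_subset_iff]
  refine forall₂_congr fun i _ => ?_
  simp [pathGen, hP.prod_mem_iff]

/-- A set of `a` positions in `[1, a t + b]` meets all windows of length `t` exactly when its
`j`-th element lies in the expected range and consecutive gaps are at most `t`. -/
theorem forall_window_iff {t a b : ℕ} (ha : 1 ≤ a) {f : Fin a → ℕ}
    (hf : StrictMono f) (hfn : ∀ j, f j ≤ a * t + b) :
    (∀ i, i + t ≤ a * t + b → ∃ k, i + 1 ≤ f k ∧ f k ≤ i + t) ↔
      ((∀ j : Fin a, (j : ℕ) * t + b + 1 ≤ f j ∧ f j ≤ ((j : ℕ) + 1) * t) ∧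
        ∀ (j : ℕ) (h : j + 1 < a), f ⟨j + 1, h⟩ - f ⟨j, by omega⟩ ≤ t) := by
  obtain ⟨c, rfl⟩ : ∃ c, a = c + 1 := ⟨a - 1, by omega⟩
  have hn : (c + 1) * t = c * t + t := by ring
  constructor
  · intro H
    have gap : ∀ (j : ℕ) (h : j + 1 < c + 1), f ⟨j + 1, h⟩ ≤ f ⟨j, by omega⟩ + t := by
      intro j h
      by_contra! hlt
      obtain ⟨k, hk1, hk2⟩ := H (f ⟨j, by omega⟩) (by have := hfn ⟨j + 1, h⟩; omega)
      have h1 : (⟨j, by omega⟩ : Fin (c + 1)) < k := hf.lt_iff_lt.1 (by omega)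
      have h2 : k < ⟨j + 1, h⟩ := hf.lt_iff_lt.1 (by omega)
      simp only [Fin.lt_def] at h1 h2
      omega
    have upper : ∀ (j : ℕ) (h : j < c + 1), f ⟨j, h⟩ ≤ (j + 1) * t := by
      intro j
      induction j with
      | zero =>
        intro h
        obtain ⟨k, -, hk⟩ := H 0 (by omega)
        have : f ⟨0, h⟩ ≤ f k := hf.monotone (Fin.le_def.2 (Nat.zero_le _))
        omega
      | succ j ih =>
        intro h
        have h1 := ih (by omega)
        have h2 := gap j h
        have : (j + 1 + 1) * t = (j + 1) * t + t := by ring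
        omega
    have lower : ∀ (d j : ℕ) (h : j < c + 1), j + d = c → j * t + b + 1 ≤ f ⟨j, h⟩ := by
      intro d
      induction d with
      | zero =>
        rintro j h rfl
        obtain ⟨k, hk, -⟩ := H (j * t + b) (by simp only [add_zero] at hn ⊢; omega)
        have : f k ≤ f ⟨j, h⟩ := hf.monotone (Fin.le_def.2 (by have := k.2; simp; omega))
        omega
      | succ d ih =>
        intro j h hj
        have h1 := ih (j + 1) (by omega) (by omega)
        have h2 := gap j (by omega)
        have : (j + 1) * t = j * t + t := by ring
        omega
    refine ⟨fun j => ⟨lower (c - j) j j.2 (by have := j.2; omega), upper j j.2⟩, fun j h => ?_⟩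
    have := gap j h
    omega
  · rintro ⟨H, gap⟩ i hi
    have hex : ∃ k, ∃ h : k < c + 1, i + 1 ≤ f ⟨k, h⟩ :=
      ⟨c, by omega, by have := (H ⟨c, by omega⟩).1; simp only at this; omega⟩
    classical
    obtain ⟨hk, hik⟩ := Nat.find_spec hex
    have hmin := fun m => Nat.find_min hex (m := m)
    generalize Nat.find hex = k at hk hik hmin
    refine ⟨⟨k, hk⟩, hik, ?_⟩
    cases k with
    | zero => have := (H ⟨0, hk⟩).2; simp only [zero_add, one_mul] at this; omega
    | succ k =>
      have h1 : ¬ i + 1 ≤ f ⟨k, by omega⟩ := fun h => hmin k (by omega) ⟨by omega, h⟩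
      have h2 := gap k hk
      omega

/-- Any `a` variables generating an ideal containing the path ideal of a line with at least
`a t` vertices generate a minimal prime, since there are `a` disjoint paths. -/
theorem span_X_mem_minimalPrimes_pathIdeal {K : Type*} [Field K] {n t a : ℕ}
    (hn : a * t ≤ n) (f : Fin a → ℕ)
    (hle : pathIdeal K n t ≤ Ideal.span
      ((fun j : Fin n => X j) '' {j : Fin n | ∃ k : Fin a, f k = (j : ℕ) + 1})) :
    Ideal.span ((fun j : Fin n => X j) '' {j : Fin n | ∃ k : Fin a, f k = (j : ℕ) + 1}) ∈
      (pathIdeal K n t).minimalPrimes := by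
  refine ⟨⟨isPrime_span_X_image _, hle⟩, fun q hq hqp => Ideal.span_le.2 ?_⟩
  have hwin : ∀ m : Fin a, (m : ℕ) * t + t ≤ n := fun m => by
    have h1 : ((m : ℕ) + 1) * t ≤ a * t := Nat.mul_le_mul_right t m.2
    have h2 : ((m : ℕ) + 1) * t = m * t + t := by ring
    omega
  choose g hg hgq using fun m : Fin a => (pathIdeal_le_iff_of_isPrime hq.1).1 hq.2 _ (hwin m)
  choose k hk using fun m : Fin a => X_mem_span_X_image_iff.1 (hqp (hgq m))
  have hdiv : ∀ m, (g m : ℕ) / t = m := fun m =>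
    Nat.div_eq_of_lt_le (hg m).1 (by rw [add_mul, one_mul]; exact (hg m).2)
  have hinj : Function.Injective k := fun m m' h => by
    have h1 := hk m
    rw [h, hk m'] at h1
    apply Fin.ext
    rw [← hdiv m, ← hdiv m', Nat.succ_injective h1]
  rintro _ ⟨j, ⟨l, hl⟩, rfl⟩
  obtain ⟨m, rfl⟩ := Finite.surjective_of_injective hinj l
  have : j = g m := Fin.ext (by have := hk m; omega)
  exact this ▸ hgq m

/-- Let `n = a t + b` with `a ≥ 1`, `0 ≤ b < t`, and let `1 ≤ i₁ < ⋯ < i_a ≤ n` (encoded by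
a strictly monotone `f : Fin a → ℕ`, `i_j = f (j-1)`).  Then `p = (x_{i₁}, …, x_{i_a})` is a
minimal prime of `I_t(L_n)` (equivalently, an associated prime of `S/I_t(L_n)`) iff
(1) `(j-1)t + b + 1 ≤ i_j ≤ j t` for all `j`, and (2) `i_{j+1} - i_j ≤ t` for all `j < a`. -/
theorem minimalPrime_pathIdeal_iff (K : Type*) [Field K] (n t a b : ℕ)
    (ht : 2 ≤ t) (htn : t ≤ n) (ha : 1 ≤ a) (hb : b < t) (hn : n = a * t + b)
    (f : Fin a → ℕ) (hf : StrictMono f) (hf1 : ∀ j, 1 ≤ f j) (hfn : ∀ j, f j ≤ n)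
    (p : Ideal (MvPolynomial (Fin n) K))
    (hp : p = Ideal.span
      ((fun j : Fin n => X j) '' {j : Fin n | ∃ k : Fin a, f k = (j : ℕ) + 1})) :
    (p ∈ (pathIdeal K n t).minimalPrimes ↔
      ((∀ j : Fin a, (j : ℕ) * t + b + 1 ≤ f j ∧ f j ≤ ((j : ℕ) + 1) * t) ∧
        ∀ (j : ℕ) (h : j + 1 < a), f ⟨j + 1, h⟩ - f ⟨j, by omega⟩ ≤ t)) ∧
    (p ∈ associatedPrimes (MvPolynomial (Fin n) K)
          (MvPolynomial (Fin n) K ⧸ pathIdeal K n t) ↔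
      ((∀ j : Fin a, (j : ℕ) * t + b + 1 ≤ f j ∧ f j ≤ ((j : ℕ) + 1) * t) ∧
        ∀ (j : ℕ) (h : j + 1 < a), f ⟨j + 1, h⟩ - f ⟨j, by omega⟩ ≤ t)) := by
  have hprime : p.IsPrime := hp ▸ isPrime_span_X_image _
  have hle : pathIdeal K n t ≤ p ↔
      ((∀ j : Fin a, (j : ℕ) * t + b + 1 ≤ f j ∧ f j ≤ ((j : ℕ) + 1) * t) ∧
        ∀ (j : ℕ) (h : j + 1 < a), f ⟨j + 1, h⟩ - f ⟨j, by omega⟩ ≤ t) := by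
    rw [pathIdeal_le_iff_of_isPrime hprime, ← forall_window_iff ha hf (hn ▸ hfn), ← hn]
    refine forall₂_congr fun i _ => ?_
    simp only [hp, X_mem_span_X_image_iff, Set.mem_ofPred_eq]
    constructor
    · rintro ⟨j, hj, k, hk⟩
      exact ⟨k, by omega, by omega⟩
    · rintro ⟨k, hk1, hk2⟩
      have h1 := hf1 k
      have h2 := hfn k
      exact ⟨⟨f k - 1, by omega⟩, ⟨by simp only; omega, by simp only; omega⟩, k,
        by simp only; omega⟩
  have hmin : pathIdeal K n t ≤ p → p ∈ (pathIdeal K n t).minimalPrimes := by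
    rw [hp]
    exact span_X_mem_minimalPrimes_pathIdeal (by omega) f
  rw [← hle]
  refine ⟨⟨fun h => h.1.2, hmin⟩, fun h => ?_, fun h => ?_⟩
  · have := IsAssociatedPrime.annihilator_le h
    rwa [Submodule.annihilator_top, Ideal.annihilator_quotient] at this
  · apply Module.associatedPrimes.minimalPrimes_annihilator_subset_associatedPrimes
    rw [Ideal.annihilator_quotient]
    exact hmin h
end

section
/- Let a ≥ 1 and t ≥ 1 be integers, and let T_{a,t} be the set of integer sequences i_1 < i_2 < ⋯ < i_a such that (j−1)t + 1 ≤ i_j ≤ j t for all 1 ≤ j ≤ a, and i_{j+1} − i_j ≤ t for all 1 ≤ j ≤ a−1. Then |T_{a,t}| = binomial(a + t − 1, a). -/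
/-- If consecutive values of an integer sequence increase by at least one, then any two values
differ by at least the difference of their indices. -/
theorem add_sub_le_of_add_one_le {a : ℕ} {s : Fin a → ℤ}
    (hs : ∀ (j : ℕ) (h : j + 1 < a), s ⟨j, Nat.lt_of_succ_lt h⟩ + 1 ≤ s ⟨j + 1, h⟩) {i j : Fin a}
    (hij : i ≤ j) : s i + ((j : ℕ) - (i : ℕ) : ℤ) ≤ s j := by
  obtain ⟨i, hi⟩ := i
  obtain ⟨j, hj⟩ := j
  replace hij : i ≤ j := hij
  induction j, hij using Nat.le_induction with
  | base => simp
  | succ k hk ih =>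
    have h₁ := ih (by omega)
    have h₂ := hs k hj
    push_cast at h₁ ⊢
    linarith

/-- The sequence `j ↦ (j + 1) t + j - g j` attached to a strictly increasing `g`. -/
def blockSeq (a t n : ℕ) (g : Fin a ↪o Fin n) (j : Fin a) : ℤ :=
  ((j : ℕ) + 1) * t + (j : ℕ) - (g j : ℕ)

theorem blockSeq_injective (a t n : ℕ) : Function.Injective (blockSeq a t n) := by
  intro g g' h
  ext j
  have := congrFun h j
  simp only [blockSeq] at this
  omega

/-- A family of integers taking its `j`-th value in the `j`-th block of length `t` is strictly
increasing. -/
theorem strictMono_of_mem_blocks {a t : ℕ} {f : Fin a → ℤ}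
    (hf : ∀ j : Fin a, (j : ℕ) * t + 1 ≤ f j ∧ f j ≤ ((j : ℕ) + 1) * t) : StrictMono f := by
  intro i j hij
  have h₁ : ((i : ℕ) + 1 : ℤ) ≤ (j : ℕ) := by exact_mod_cast hij
  have h₂ := mul_le_mul_of_nonneg_right h₁ (Int.natCast_nonneg t)
  linarith [(hf i).2, (hf j).1]

theorem range_blockSeq (a t : ℕ) (ha : 1 ≤ a) (ht : 1 ≤ t) :
    Set.range (blockSeq a t (a + t - 1)) = {f : Fin a → ℤ | StrictMono f ∧
        (∀ j : Fin a, (j : ℕ) * t + 1 ≤ f j ∧ f j ≤ ((j : ℕ) + 1) * t) ∧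
        ∀ (j : ℕ) (h : j + 1 < a), f ⟨j + 1, h⟩ - f ⟨j, Nat.lt_of_succ_lt h⟩ ≤ t} := by
  ext f
  constructor
  · rintro ⟨g, rfl⟩
    have hg : ∀ (j : ℕ) (h : j + 1 < a),
        ((g ⟨j, Nat.lt_of_succ_lt h⟩ : ℕ) : ℤ) + 1 ≤ (g ⟨j + 1, h⟩ : ℕ) := by
      intro j h
      have : g ⟨j, Nat.lt_of_succ_lt h⟩ < g ⟨j + 1, h⟩ := g.strictMono (by simp)
      exact_mod_cast this
    have hblock : ∀ j : Fin a, (j : ℕ) * t + 1 ≤ blockSeq a t (a + t - 1) g j ∧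
        blockSeq a t (a + t - 1) g j ≤ ((j : ℕ) + 1) * t := by
      intro j
      have h₁ := add_sub_le_of_add_one_le (s := fun j => ((g j : ℕ) : ℤ)) hg
        (i := ⟨0, by omega⟩) (j := j) (Nat.zero_le _)
      have h₂ := add_sub_le_of_add_one_le (s := fun j => ((g j : ℕ) : ℤ)) hg
        (i := j) (j := ⟨a - 1, by omega⟩) (Nat.le_sub_one_of_lt j.isLt)
      have h₃ := (g ⟨a - 1, by omega⟩).isLt
      simp only [blockSeq, add_mul, one_mul] at h₁ h₂ ⊢
      constructor <;> omega
    refine ⟨strictMono_of_mem_blocks hblock, hblock, fun j h => ?_⟩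
    have := hg j h
    simp only [blockSeq]
    push_cast
    linarith
  · rintro ⟨-, hblock, hstep⟩
    let s : Fin a → ℤ := fun j => ((j : ℕ) + 1) * t + (j : ℕ) - f j
    have hs : ∀ (j : ℕ) (h : j + 1 < a), s ⟨j, Nat.lt_of_succ_lt h⟩ + 1 ≤ s ⟨j + 1, h⟩ := by
      intro j h
      have := hstep j h
      simp only [s]
      push_cast
      linarith
    have hnonneg : ∀ j, 0 ≤ s j := by
      intro j
      have := (hblock j).2
      simp only [s]
      omega
    have hlt : ∀ j, s j < (a + t - 1 : ℕ) := by
      intro j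
      have := (hblock j).1
      have := j.isLt
      simp only [s, add_mul, one_mul]
      omega
    have hmono : StrictMono fun j => (⟨(s j).toNat, by
        have := hlt j
        have := hnonneg j
        omega⟩ : Fin (a + t - 1)) := by
      intro i j hij
      have h₁ := add_sub_le_of_add_one_le hs hij.le
      have h₂ := hnonneg i
      rw [Fin.lt_def] at hij ⊢
      simp only
      omega
    refine ⟨OrderEmbedding.ofStrictMono _ hmono, ?_⟩
    funext j
    have := hnonneg j
    simp only [blockSeq, OrderEmbedding.coe_ofStrictMono, Int.toNat_of_nonneg this, s]
    ring

/-- For `a, t ≥ 1`, the number of integer sequences `i₁ < i₂ < ⋯ < i_a` (encoded as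
functions `f : Fin a → ℤ`, `i_j = f (j-1)`) with `(j-1)t + 1 ≤ i_j ≤ j t` for all
`1 ≤ j ≤ a` and `i_{j+1} - i_j ≤ t` for all `1 ≤ j ≤ a-1` is `(a + t - 1).choose a`. -/
theorem card_T (a t : ℕ) (ha : 1 ≤ a) (ht : 1 ≤ t) :
    Set.ncard {f : Fin a → ℤ | StrictMono f ∧
        (∀ j : Fin a, (j : ℕ) * t + 1 ≤ f j ∧ f j ≤ ((j : ℕ) + 1) * t) ∧
        ∀ (j : ℕ) (h : j + 1 < a), f ⟨j + 1, h⟩ - f ⟨j, by omega⟩ ≤ t} =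
      (a + t - 1).choose a := by
  rw [← range_blockSeq a t ha ht, Set.ncard_range_of_injective (blockSeq_injective a t _),
    Nat.card_congr Set.powersetCard.ofFinEmbEquiv, Set.powersetCard.card, Nat.card_fin]
end

section
/- Let n ≥ t ≥ 1 be integers and write n = a t + b with a ≥ 1 and 0 ≤ b ≤ t−1. Let X_{n,t} be the set of integer sequences i_1 < i_2 < ⋯ < i_a such that (j−1)t + b + 1 ≤ i_j ≤ j t for all 1 ≤ j ≤ a, and i_{j+1} − i_j ≤ t for all 1 ≤ j ≤ a−1. Then |X_{n,t}| = binomial(a + t − b − 1, a). -/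
theorem Fin.add_le_add_of_strictMono {k : ℕ} {g : Fin k → ℕ} (hg : StrictMono g) {i j : Fin k}
    (hij : i ≤ j) : g i + j ≤ g j + i := by
  obtain ⟨j, hj⟩ := j
  induction j with
  | zero =>
    obtain rfl : i = ⟨0, hj⟩ := le_antisymm hij (Fin.mk_le_mk.2 (Nat.zero_le _))
    rfl
  | succ j ih =>
    rcases hij.eq_or_lt with rfl | hlt
    · rfl
    · have hle := ih (by omega) (Nat.lt_succ_iff.1 hlt)
      have hlt' : g ⟨j, by omega⟩ < g ⟨j + 1, hj⟩ := hg (Nat.lt_succ_self j)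
      simp only at hle ⊢
      omega

theorem Fin.natCard_orderEmbedding (a N : ℕ) : Nat.card (Fin a ↪o Fin N) = N.choose a := by
  rw [Nat.card_congr Set.powersetCard.ofFinEmbEquiv, Set.powersetCard.card, Nat.card_fin]

/-- The map `g ↦ (j ↦ t (j + 1) + j - g j)`, under which the order embeddings
`Fin a ↪o Fin (a + t - b - 1)` parametrize the sequences of `card_X`. -/
def seqOfOrderEmbedding (a t N : ℕ) (g : Fin a ↪o Fin N) (j : Fin a) : ℤ :=
  ((j : ℕ) + 1) * t + (j : ℕ) - (g j : ℕ)

theorem seqOfOrderEmbedding_injective (a t N : ℕ) :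
    Function.Injective (seqOfOrderEmbedding a t N) := by
  intro g g' h
  ext j
  have := congrFun h j
  simp only [seqOfOrderEmbedding] at this
  omega

theorem range_seqOfOrderEmbedding {t b : ℕ} (m : ℕ) (hb : b < t) :
    Set.range (seqOfOrderEmbedding (m + 1) t (m + 1 + t - b - 1)) =
      {f : Fin (m + 1) → ℤ | StrictMono f ∧
        (∀ j : Fin (m + 1), (j : ℕ) * t + b + 1 ≤ f j ∧ f j ≤ ((j : ℕ) + 1) * t) ∧
        ∀ (j : ℕ) (h : j + 1 < m + 1), f ⟨j + 1, h⟩ - f ⟨j, by omega⟩ ≤ t} := by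
  ext f
  constructor
  · rintro ⟨g, rfl⟩
    have hg : StrictMono fun j => (g j : ℕ) := fun i j h => g.strictMono h
    have bounds (j : Fin (m + 1)) :
        (j : ℕ) * t + b + 1 ≤ seqOfOrderEmbedding _ t _ g j ∧
          seqOfOrderEmbedding _ t _ g j ≤ ((j : ℕ) + 1) * t := by
      have h0 := Fin.add_le_add_of_strictMono hg (Fin.zero_le j)
      have h1 := Fin.add_le_add_of_strictMono hg (Fin.le_last j)
      have h2 := (g (Fin.last m)).isLt
      simp only [Fin.val_zero, Fin.val_last, add_zero] at h0 h1
      simp only [seqOfOrderEmbedding, add_mul, one_mul]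
      constructor <;> omega
    refine ⟨Fin.strictMono_iff_lt_succ.2 fun i => ?_, bounds, fun j h => ?_⟩
    · have h1 := (bounds i.castSucc).2
      have h2 := (bounds i.succ).1
      simp only [Fin.val_castSucc, Fin.val_succ, Nat.cast_add, Nat.cast_one] at h1 h2
      linarith
    · have : (g ⟨j, by omega⟩ : ℕ) < g ⟨j + 1, h⟩ := hg (Nat.lt_succ_self j)
      simp only [seqOfOrderEmbedding, Nat.cast_add, Nat.cast_one, add_mul, one_mul]
      omega
  · rintro ⟨-, bounds, gap⟩
    have hN (j : Fin (m + 1)) :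
        (((j : ℕ) + 1) * t + (j : ℕ) - f j).toNat < m + 1 + t - b - 1 := by
      have := bounds j
      have := j.isLt
      simp only [add_mul, one_mul] at *
      omega
    let g (j : Fin (m + 1)) : Fin (m + 1 + t - b - 1) := ⟨_, hN j⟩
    have hg : StrictMono g := Fin.strictMono_iff_lt_succ.2 fun i => by
      have h1 := bounds i.castSucc
      have h2 := bounds i.succ
      have h3 : f i.succ - f i.castSucc ≤ t := gap i (by omega)
      simp only [g, Fin.mk_lt_mk, Fin.val_castSucc, Fin.val_succ, Nat.cast_add, Nat.cast_one,
        add_mul, one_mul] at h1 h2 h3 ⊢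
      omega
    refine ⟨OrderEmbedding.ofStrictMono g hg, funext fun j => ?_⟩
    have := bounds j
    simp only [seqOfOrderEmbedding, OrderEmbedding.coe_ofStrictMono, g, add_mul, one_mul] at this ⊢
    omega


/-- Let `n = a t + b` with `n ≥ t ≥ 1`, `a ≥ 1`, `0 ≤ b ≤ t - 1`.  The number of integer
sequences `i₁ < i₂ < ⋯ < i_a` (encoded as functions `f : Fin a → ℤ`, `i_j = f (j-1)`) with
`(j-1)t + b + 1 ≤ i_j ≤ j t` for all `1 ≤ j ≤ a` and `i_{j+1} - i_j ≤ t` for all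
`1 ≤ j ≤ a-1` is `(a + t - b - 1).choose a`. -/
theorem card_X (n t a b : ℕ) (ht : 1 ≤ t) (htn : t ≤ n) (ha : 1 ≤ a) (hb : b ≤ t - 1)
    (hn : n = a * t + b) :
    Set.ncard {f : Fin a → ℤ | StrictMono f ∧
        (∀ j : Fin a, (j : ℕ) * t + b + 1 ≤ f j ∧ f j ≤ ((j : ℕ) + 1) * t) ∧
        ∀ (j : ℕ) (h : j + 1 < a), f ⟨j + 1, h⟩ - f ⟨j, by omega⟩ ≤ t} =
      (a + t - b - 1).choose a := by
  obtain ⟨m, rfl⟩ := Nat.exists_eq_add_of_le' ha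
  rw [← range_seqOfOrderEmbedding m (by omega), ← Set.image_univ,
    Set.ncard_image_of_injective _ (seqOfOrderEmbedding_injective _ _ _), Set.ncard_univ,
    Fin.natCard_orderEmbedding]
end
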